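/- arXiv:2105.13883 — 2 statements merged into one kernel-verified Lean document; each statement's English description precedes it below -/
import Mathlib

section
/- (Hilbert irreducibility over the ring ℤ.) Let x = (x_1,…,x_r) and y = (y_1,…,y_m) with r, m ≥ 1, and let P_1,…,P_ℓ ∈ ℤ[x,y] (ℓ ≥ 1) be irreducible in ℤ[x,y] and of degree ≥ 1 in the variables y. Assume there is no prime p such that p divides every coefficient of the polynomial ∏_{j=1}^ℓ P_j(n,y) ∈ ℤ[y] for every n ∈ ℤ^r. Then the set H of all n ∈ ℤ^r such that each P_j(n,y) is irreducible in ℤ[y] (j = 1,…,ℓ) has positive lower density for symmetric boxes (liminf_{B→∞} #(H ∩ [−B,B]^r)/(2B+1)^r > 0); in particular H is Zariski-dense in ℤ^r (for every nonzero Q ∈ ℚ[x] there exists n ∈ H with Q(n) ≠ 0). -/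
open MvPolynomial Filter

/-- Specialization `P(x,y) ↦ P(n,y)` of a polynomial in the variables `x ⊕ y`
at an integer point `n`. -/
noncomputable def specX (r m : ℕ) (n : Fin r → ℤ) :
    MvPolynomial (Fin r ⊕ Fin m) ℤ →+* MvPolynomial (Fin m) ℤ :=
  eval₂Hom (C : ℤ →+* MvPolynomial (Fin m) ℤ) (Sum.elim (fun i => C (n i)) fun j => X j)

namespace HilbertIrreducibility

theorem eval_aeval_apply {σ τ R : Type*} [CommSemiring R] (x : τ → R)
    (g : σ → MvPolynomial τ R) (Q : MvPolynomial σ R) :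
    eval x (aeval g Q) = eval (fun i => eval x (g i)) Q := by
  induction Q using MvPolynomial.induction_on with
  | C a => simp
  | add P Q hP hQ => rw [map_add, map_add, map_add, hP, hQ]
  | mul_X P i hP => rw [map_mul, map_mul, map_mul, hP, aeval_X, eval_X]

/-- A subspace of `ℚ^ι` is cut out by finitely many integral linear forms. -/
theorem exists_integral_linear_forms {ι : Type*} [Fintype ι] [DecidableEq ι]
    (V : Submodule ℚ (ι → ℚ)) :
    ∃ (n : ℕ) (a : Fin n → ι → ℤ), ∀ z : ι → ℚ, z ∈ V ↔ ∀ b, ∑ i, (a b i : ℚ) * z i = 0 := by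
  let B := Module.finBasis ℚ ((ι → ℚ) ⧸ V)
  let f : Fin (Module.finrank ℚ ((ι → ℚ) ⧸ V)) × ι → ℚ :=
    fun x => B.repr (V.mkQ (Pi.single x.2 1)) x.1
  obtain ⟨d, hd⟩ := IsLocalization.exist_integer_multiples_of_finite (nonZeroDivisors ℤ) f
  choose a ha using hd
  refine ⟨_, fun b i => a (b, i), fun z => ?_⟩
  have hd0 : ((d : ℤ) : ℚ) ≠ 0 := by exact_mod_cast nonZeroDivisors.ne_zero d.2
  have key : ∀ b, ∑ i, (a (b, i) : ℚ) * z i = (d : ℤ) * B.repr (V.mkQ z) b := by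
    intro b
    have h1 : V.mkQ z = ∑ i, z i • V.mkQ (Pi.single i 1) := by
      conv_lhs => rw [pi_eq_sum_univ' z]
      simp only [map_sum, map_smul]
    rw [h1]
    simp only [map_sum, map_smul, Finsupp.coe_finsetSum, Finset.sum_apply, Finsupp.smul_apply,
      smul_eq_mul, Finset.mul_sum]
    refine Finset.sum_congr rfl fun i _ => ?_
    have := ha (b, i)
    simp only [f, eq_intCast, Algebra.smul_def] at this
    rw [this]
    ring
  simp only [key, mul_eq_zero, hd0, false_or]
  rw [← Submodule.Quotient.mk_eq_zero V, ← Submodule.mkQ_apply, ← B.repr.map_eq_zero_iff]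
  exact DFunLike.ext_iff

/-- If a small integral vector is congruent, modulo a large integer, to a combination of the
vectors `v k`, then it is a rational combination of them. -/
theorem exists_rat_combination_of_dvd {ι κ : Type*} [Fintype ι] [Fintype κ] (v : κ → ι → ℤ) :
    ∃ C : ℕ, ∀ (z : ι → ℤ) (M Z : ℕ), (∀ i, |z i| ≤ Z) → C * Z < M →
      (∃ c : κ → ℤ, ∀ i, (M : ℤ) ∣ z i - ∑ k, c k * v k i) →
      ∃ q : κ → ℚ, ∀ i, (z i : ℚ) = ∑ k, q k * v k i := by
  classical
  let V : Submodule ℚ (ι → ℚ) := Submodule.span ℚ (Set.range fun k i => (v k i : ℚ))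
  obtain ⟨n, a, ha⟩ := exists_integral_linear_forms V
  refine ⟨∑ b, ∑ i, (a b i).natAbs, fun z M Z hz hM ⟨c, hc⟩ => ?_⟩
  have hv : ∀ k b, ∑ i, a b i * v k i = 0 := by
    intro k b
    have := (ha _).1 (Submodule.subset_span ⟨k, rfl⟩) b
    simp only at this
    exact_mod_cast this
  have hmem : (fun i => (z i : ℚ)) ∈ V := by
    rw [ha]
    intro b
    have hdvd : (M : ℤ) ∣ ∑ i, a b i * z i := by
      have h1 : ∑ i, a b i * z i = ∑ i, a b i * (z i - ∑ k, c k * v k i) := by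
        have h2 : ∑ i, a b i * ∑ k, c k * v k i = 0 := by
          simp only [Finset.mul_sum]
          rw [Finset.sum_comm]
          refine Finset.sum_eq_zero fun k _ => ?_
          have := congrArg (c k * ·) (hv k b)
          simp only [Finset.mul_sum, mul_zero] at this
          rw [← this]
          exact Finset.sum_congr rfl fun i _ => by ring
        simp only [mul_sub, Finset.sum_sub_distrib, h2, sub_zero]
      rw [h1]
      exact Finset.dvd_sum fun i _ => Dvd.dvd.mul_left (hc i) _
    have hle : |∑ i, a b i * z i| < M := by
      calc |∑ i, a b i * z i| ≤ ∑ i, |a b i * z i| := Finset.abs_sum_le_sum_abs _ _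
        _ ≤ ∑ i, ((a b i).natAbs : ℤ) * Z := by
            refine Finset.sum_le_sum fun i _ => ?_
            rw [abs_mul, Int.natCast_natAbs]
            exact mul_le_mul_of_nonneg_left (hz i) (abs_nonneg _)
        _ = ((∑ i, (a b i).natAbs : ℕ) : ℤ) * Z := by push_cast; rw [Finset.sum_mul]
        _ ≤ ((∑ b, ∑ i, (a b i).natAbs : ℕ) : ℤ) * Z := by
            refine mul_le_mul_of_nonneg_right ?_ (by positivity)
            exact_mod_cast Finset.single_le_sum (f := fun b => ∑ i, (a b i).natAbs)
              (fun _ _ => Nat.zero_le _) (Finset.mem_univ b)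
        _ < M := by exact_mod_cast hM
    have := Int.eq_zero_of_abs_lt_dvd hdvd hle
    exact_mod_cast this
  obtain ⟨q, hq⟩ := (Submodule.mem_span_range_iff_exists_fun ℚ).1 hmem
  refine ⟨q, fun i => ?_⟩
  have := congrFun hq i
  simp only [Finset.sum_apply, Pi.smul_apply, smul_eq_mul] at this
  exact this.symm

/-- The polynomial with prescribed coefficients on the monomials all of whose exponents are
less than `k`. -/
noncomputable def boxPoly {σ R : Type*} [Fintype σ] [CommSemiring R] (k : ℕ)
    (c : (σ → Fin k) → R) : MvPolynomial σ R :=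
  open Classical in ∑ μ, C (c μ) * ∏ i, X i ^ (μ i : ℕ)

theorem eval_boxPoly {σ R : Type*} [Fintype σ] [CommSemiring R] (k : ℕ)
    (c : (σ → Fin k) → R) (x : σ → R) :
    eval x (boxPoly k c) = open Classical in ∑ μ, c μ * ∏ i, x i ^ (μ i : ℕ) := by
  simp [boxPoly]

theorem totalDegree_boxPoly_le {σ R : Type*} [Fintype σ] [CommSemiring R] (k : ℕ)
    (c : (σ → Fin k) → R) : (boxPoly k c).totalDegree ≤ k * Fintype.card σ := by
  classical
  refine totalDegree_finsetSum_le fun μ _ => (totalDegree_mul _ _).trans ?_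
  rw [totalDegree_C, zero_add]
  refine (totalDegree_finsetProd _ _).trans ?_
  calc ∑ i, (X i ^ (μ i : ℕ) : MvPolynomial σ R).totalDegree ≤ ∑ _i : σ, k := by
        refine Finset.sum_le_sum fun i _ => ?_
        refine (totalDegree_pow _ _).trans ?_
        have h1 : (X i : MvPolynomial σ R).totalDegree ≤ 1 := by
          rcases subsingleton_or_nontrivial R with h | h
          · rw [Subsingleton.elim (X i : MvPolynomial σ R) 0]; simp
          · simp
        nlinarith [(μ i).2]
    _ = k * Fintype.card σ := by simp [mul_comm]

/-- Functions on a finite set of lattice points which are small, and congruent to polynomials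
modulo a large integer, are interpolated by polynomials of bounded degree. -/
theorem exists_interpolation {σ : Type*} [Fintype σ] (W : Finset (σ → ℤ)) (k : ℕ) :
    ∃ C : ℕ, ∀ S ⊆ W, ∀ (z : (σ → ℤ) → ℤ) (M Z : ℕ), (∀ s ∈ S, |z s| ≤ Z) → C * Z < M →
      (∃ c : (σ → Fin k) → ℤ, ∀ s ∈ S, (M : ℤ) ∣ z s - eval s (boxPoly k c)) →
      ∃ q : MvPolynomial σ ℚ, q.totalDegree ≤ k * Fintype.card σ ∧
        ∀ s ∈ S, (z s : ℚ) = eval (fun i => (s i : ℚ)) q := by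
  classical
  have h : ∀ S : Finset (σ → ℤ), ∃ C : ℕ, ∀ (z : S → ℤ) (M Z : ℕ), (∀ i, |z i| ≤ Z) →
      C * Z < M → (∃ c : (σ → Fin k) → ℤ, ∀ s : S, (M : ℤ) ∣ z s -
        ∑ μ, c μ * ∏ i, (s : σ → ℤ) i ^ (μ i : ℕ)) →
      ∃ q : (σ → Fin k) → ℚ, ∀ s : S, (z s : ℚ) =
        ∑ μ, q μ * ((∏ i, (s : σ → ℤ) i ^ (μ i : ℕ) : ℤ) : ℚ) :=
    fun S => exists_rat_combination_of_dvd fun (μ : σ → Fin k) (s : S) =>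
      ∏ i, (s : σ → ℤ) i ^ (μ i : ℕ)
  choose C hC using h
  refine ⟨W.powerset.sup C, fun S hS z M Z hz hM ⟨c, hc⟩ => ?_⟩
  have hCS : C S ≤ W.powerset.sup C := Finset.le_sup (Finset.mem_powerset.2 hS)
  obtain ⟨q, hq⟩ := hC S (fun s => z s) M Z (fun s => hz s s.2)
    ((Nat.mul_le_mul_right Z hCS).trans_lt hM) ⟨c, fun s => by
      have := hc s s.2
      rw [eval_boxPoly] at this
      convert this⟩
  refine ⟨boxPoly k q, totalDegree_boxPoly_le _ _, fun s hs => ?_⟩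
  rw [eval_boxPoly]
  have := hq ⟨s, hs⟩
  push_cast at this
  convert this

/-- On points congruent to `N` modulo `p`, a polynomial is congruent modulo `p ^ k` to a polynomial
of bounded degree. -/
theorem exists_boxPoly_congr {σ : Type*} [Fintype σ] (Q : MvPolynomial σ ℤ) (N : σ → ℤ)
    (p : ℤ) (k : ℕ) :
    ∃ c : (σ → Fin k) → ℤ, ∀ s : σ → ℤ,
      p ^ k ∣ eval (fun i => N i + p * s i) Q - eval s (boxPoly k c) := by
  classical
  have key : ∀ Q' : MvPolynomial σ ℤ, ∃ c : (σ → Fin k) → ℤ, ∀ s : σ → ℤ,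
      p ^ k ∣ eval (fun i => p * s i) Q' - eval s (boxPoly k c) := by
    intro Q'
    induction Q' using MvPolynomial.induction_on' with
    | monomial μ a =>
      by_cases hμ : ∀ i, μ i < k
      · refine ⟨Pi.single (fun i => ⟨μ i, hμ i⟩) (a * ∏ i, p ^ μ i), fun s => ?_⟩
        rw [eval_boxPoly, eval_monomial, Finsupp.prod_fintype _ _ (by simp),
          Finset.sum_eq_single (fun i => ⟨μ i, hμ i⟩)]
        · simp [mul_pow, Finset.prod_mul_distrib, mul_assoc]
        · intro b _ hb
          simp [hb]
        · simp
      · push Not at hμ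
        obtain ⟨i, hi⟩ := hμ
        refine ⟨0, fun s => ?_⟩
        rw [eval_boxPoly, eval_monomial, Finsupp.prod_fintype _ _ (by simp)]
        simp only [Pi.zero_apply, zero_mul, Finset.sum_const_zero, sub_zero]
        refine Dvd.dvd.mul_left (dvd_trans ?_ (Finset.dvd_prod_of_mem _ (Finset.mem_univ i))) _
        rw [mul_pow]
        exact Dvd.dvd.mul_right (pow_dvd_pow _ hi) _
    | add P Q hP hQ =>
      obtain ⟨c, hc⟩ := hP
      obtain ⟨d, hd⟩ := hQ
      refine ⟨c + d, fun s => ?_⟩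
      have := dvd_add (hc s) (hd s)
      have h2 : eval s (boxPoly k (c + d)) = eval s (boxPoly k c) + eval s (boxPoly k d) := by
        simp [eval_boxPoly, add_mul, Finset.sum_add_distrib]
      rw [h2, map_add]
      rwa [sub_add_sub_comm] at this
  obtain ⟨c, hc⟩ := key (aeval (fun i => C (N i) + X i) Q)
  refine ⟨c, fun s => ?_⟩
  have := hc s
  rw [eval_aeval_apply] at this
  simpa using this

theorem map_eval_map_C {σ R : Type*} [CommSemiring R] (N : σ → R) (f : Polynomial R) :
    (f.map (C : R →+* MvPolynomial σ R)).map (eval N) = f := by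
  have h : (eval N).comp (C : R →+* MvPolynomial σ R) = RingHom.id R :=
    RingHom.ext fun x => eval_C x
  rw [Polynomial.map_map, h, Polynomial.map_id]

theorem C_mul_modByMonic {R : Type*} [CommRing R] (c : R) (f g : Polynomial R) :
    (Polynomial.C c * f) %ₘ g = Polynomial.C c * (f %ₘ g) := by
  rw [← Polynomial.smul_eq_C_mul, ← Polynomial.smul_eq_C_mul, Polynomial.smul_modByMonic]

/-- Newton correction: if `G`, `H` approximate the factors `g`, `h` modulo `p ^ k`, then the
remainder of `t * (g * h - G * H)` gives the correction to `G` modulo `p ^ (k + 1)`. -/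
theorem pow_succ_dvd_newton_correction {p α : ℤ} {k : ℕ} (hk : 1 ≤ k)
    {g h G H g₀ t w : Polynomial ℤ} (hg₀ : g₀.Monic)
    (hgG : Polynomial.C (p ^ k) ∣ g - G) (hhH : Polynomial.C (p ^ k) ∣ h - H)
    (hdeg : (g - G).degree < g₀.degree) (hp : p ≠ 0)
    (hred : Polynomial.C p ∣ g - Polynomial.C α * g₀)
    (hinv : Polynomial.C p ∣ t * h - 1 - w * g₀) :
    Polynomial.C (p ^ (k + 1)) ∣ g - (G + (t * (g * h - G * H)) %ₘ g₀) := by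
  obtain ⟨γ, hγ⟩ := hgG
  obtain ⟨η, hη⟩ := hhH
  obtain ⟨u, hu⟩ := hred
  obtain ⟨v, hv⟩ := hinv
  obtain ⟨l, rfl⟩ := Nat.exists_eq_add_of_le' hk
  set P : Polynomial ℤ := Polynomial.C p with hP
  have hPk : ∀ n, Polynomial.C (p ^ n) = P ^ n := fun n => by rw [hP, Polynomial.C_pow]
  have hγdeg : γ.degree < g₀.degree := by
    rw [hγ, Polynomial.degree_C_mul (pow_ne_zero _ hp)] at hdeg
    exact hdeg
  rw [hPk] at hγ hη
  have key : t * (g * h - G * H) = Polynomial.C (p ^ (l + 1)) *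
      (γ + (g₀ * (w * γ + t * Polynomial.C α * η) +
        Polynomial.C p * (v * γ + t * u * η - t * P ^ l * γ * η))) := by
    rw [hPk, ← hP]
    have hG : G = g - P ^ (l + 1) * γ := by rw [← hγ]; ring
    have hH : H = h - P ^ (l + 1) * η := by rw [← hη]; ring
    rw [hG, hH]
    have hgu : g = P * u + Polynomial.C α * g₀ := by rw [← hu]; ring
    have hv' : t * h = P * v + 1 + w * g₀ := by rw [← hv]; ring
    calc _ = P ^ (l + 1) * (γ * (t * h) + t * η * g - t * P ^ (l + 1) * γ * η) := by ring
      _ = _ := by rw [hv', hgu]; ring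
  rw [key, C_mul_modByMonic, Polynomial.add_modByMonic, Polynomial.add_modByMonic,
    C_mul_modByMonic, Polynomial.self_mul_modByMonic hg₀,
    (Polynomial.modByMonic_eq_self_iff hg₀).2 hγdeg, hPk, hPk, zero_add, ← hP]
  refine ⟨-((v * γ + t * u * η - t * P ^ l * γ * η) %ₘ g₀), ?_⟩
  linear_combination hγ

theorem degree_sub_map_lt {σ : Type*} {e : ℕ} {a : MvPolynomial σ ℤ} {N : σ → ℤ}
    {g : Polynomial ℤ} {G : Polynomial (MvPolynomial σ ℤ)} (hg : g.natDegree ≤ e)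
    (hga : g.coeff e = eval N a) (hG : G.natDegree ≤ e) (hGa : G.coeff e = a) :
    (g - G.map (eval N)).degree < e := by
  rw [Polynomial.degree_lt_iff_coeff_zero]
  intro m hm
  rcases hm.eq_or_lt with rfl | hm
  · simp [hga, hGa]
  · rw [Polynomial.coeff_sub, Polynomial.coeff_map,
      Polynomial.coeff_eq_zero_of_natDegree_lt (hg.trans_lt hm),
      Polynomial.coeff_eq_zero_of_natDegree_lt (hG.trans_lt hm)]
    simp

theorem exists_hensel_step {σ : Type*} {p α : ℤ} {k e : ℕ} (hk : 1 ≤ k) (hp : p ≠ 0)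
    {𝒩 : Set (σ → ℤ)} {Φ G H : Polynomial (MvPolynomial σ ℤ)} {a : MvPolynomial σ ℤ}
    {g h : (σ → ℤ) → Polynomial ℤ} {g₀ t w : Polynomial ℤ}
    (hgh : ∀ N ∈ 𝒩, g N * h N = Φ.map (eval N))
    (hg : ∀ N ∈ 𝒩, (g N).natDegree ≤ e) (hga : ∀ N ∈ 𝒩, (g N).coeff e = eval N a)
    (hG : G.natDegree ≤ e) (hGa : G.coeff e = a)
    (hgG : ∀ N ∈ 𝒩, Polynomial.C (p ^ k) ∣ g N - G.map (eval N))
    (hhH : ∀ N ∈ 𝒩, Polynomial.C (p ^ k) ∣ h N - H.map (eval N))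
    (hg₀ : g₀.Monic) (hg₀e : g₀.natDegree = e)
    (hred : ∀ N ∈ 𝒩, Polynomial.C p ∣ g N - Polynomial.C α * g₀)
    (hinv : ∀ N ∈ 𝒩, Polynomial.C p ∣ t * h N - 1 - w * g₀) :
    ∃ G' : Polynomial (MvPolynomial σ ℤ), G'.natDegree ≤ e ∧ G'.coeff e = a ∧
      ∀ N ∈ 𝒩, Polynomial.C (p ^ (k + 1)) ∣ g N - G'.map (eval N) := by
  have hg₀' : (g₀.map (C : ℤ →+* MvPolynomial σ ℤ)).Monic := hg₀.map _
  set R := (t.map (C : ℤ →+* MvPolynomial σ ℤ) * (Φ - G * H)) %ₘ g₀.map C with hR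
  have hRdeg : R.degree < e := by
    have := Polynomial.degree_modByMonic_lt (t.map (C : ℤ →+* MvPolynomial σ ℤ) * (Φ - G * H)) hg₀'
    rwa [hg₀.degree_map, Polynomial.degree_eq_natDegree hg₀.ne_zero, hg₀e] at this
  refine ⟨G + R, ?_, ?_, fun N hN => ?_⟩
  · exact Polynomial.natDegree_add_le_of_degree_le hG
      (Polynomial.natDegree_le_of_degree_le hRdeg.le)
  · rw [Polynomial.coeff_add, hGa, Polynomial.coeff_eq_zero_of_degree_lt hRdeg, add_zero]
  · have h1 : R.map (eval N) =
        (t * (g N * h N - G.map (eval N) * H.map (eval N))) %ₘ g₀ := by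
      rw [hR, Polynomial.map_modByMonic _ hg₀', Polynomial.map_mul, Polynomial.map_sub,
        Polynomial.map_mul, map_eval_map_C, map_eval_map_C, hgh N hN]
    rw [Polynomial.map_add, h1]
    refine pow_succ_dvd_newton_correction hk hg₀ (hgG N hN) (hhH N hN) ?_ hp (hred N hN)
      (hinv N hN)
    rw [Polynomial.degree_eq_natDegree hg₀.ne_zero, hg₀e]
    exact degree_sub_map_lt (hg N hN) (hga N hN) hG hGa

/-- A polynomial whose leading coefficient is prime to `p` is congruent modulo `p` to a multiple
of a monic polynomial. -/
theorem exists_monic_congr {p α β : ℤ} {e : ℕ} {g : Polynomial ℤ} (hg : g.natDegree ≤ e)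
    (hga : g.coeff e = α) (hαβ : p ∣ α * β - 1) :
    ∃ g₀ : Polynomial ℤ, g₀.Monic ∧ g₀.natDegree = e ∧
      Polynomial.C p ∣ g - Polynomial.C α * g₀ := by
  obtain ⟨c, hc⟩ := hαβ
  have hmon : (Polynomial.C β * g + Polynomial.C (1 - α * β) * Polynomial.X ^ e).coeff e = 1 := by
    rw [Polynomial.coeff_add, Polynomial.coeff_C_mul, hga, Polynomial.coeff_C_mul_X_pow, if_pos rfl]
    ring
  have hle : (Polynomial.C β * g + Polynomial.C (1 - α * β) * Polynomial.X ^ e).natDegree ≤ e := by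
    refine Polynomial.natDegree_add_le_of_degree_le
      ((Polynomial.natDegree_C_mul_le _ _).trans hg) ?_
    exact Polynomial.natDegree_C_mul_X_pow_le _ _
  refine ⟨Polynomial.C β * g + Polynomial.C (1 - α * β) * Polynomial.X ^ e,
    Polynomial.monic_of_natDegree_le_of_coeff_eq_one e hle hmon, ?_, ?_⟩
  · exact le_antisymm hle (Polynomial.le_natDegree_of_ne_zero (by rw [hmon]; exact one_ne_zero))
  · refine ⟨Polynomial.C c * (Polynomial.C α * Polynomial.X ^ e - g), ?_⟩
    have h1 : (Polynomial.C α : Polynomial ℤ) * Polynomial.C β =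
        Polynomial.C p * Polynomial.C c + 1 := by
      rw [← Polynomial.C_mul, ← Polynomial.C_mul, ← hc]; simp
    have h2 : (Polynomial.C (1 - α * β) : Polynomial ℤ) = - (Polynomial.C p * Polynomial.C c) := by
      rw [← Polynomial.C_mul, ← hc, ← Polynomial.C_neg]; congr 1; ring
    rw [h2]
    linear_combination (-g) * h1

/-- Hensel lifting in families: coprime factors which are constant modulo `p` are given by
polynomials in the parameters modulo `p ^ k`. -/
theorem exists_hensel_family {σ : Type*} {p : ℤ} {e e' : ℕ} (hp : p ≠ 0)
    {𝒩 : Set (σ → ℤ)} {Φ : Polynomial (MvPolynomial σ ℤ)} {a : MvPolynomial σ ℤ}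
    {g h : (σ → ℤ) → Polynomial ℤ} {s t : Polynomial ℤ} {N₀ : σ → ℤ} {β : ℤ} (hN₀ : N₀ ∈ 𝒩)
    (hgh : ∀ N ∈ 𝒩, g N * h N = Φ.map (eval N))
    (hg : ∀ N ∈ 𝒩, (g N).natDegree ≤ e) (hga : ∀ N ∈ 𝒩, (g N).coeff e = eval N a)
    (hh : ∀ N ∈ 𝒩, (h N).natDegree ≤ e') (hha : ∀ N ∈ 𝒩, (h N).coeff e' = eval N a)
    (hgN : ∀ N ∈ 𝒩, Polynomial.C p ∣ g N - g N₀) (hhN : ∀ N ∈ 𝒩, Polynomial.C p ∣ h N - h N₀)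
    (hβ : p ∣ eval N₀ a * β - 1) (hst : Polynomial.C p ∣ s * g N₀ + t * h N₀ - 1)
    {k : ℕ} (hk : 1 ≤ k) :
    ∃ G H : Polynomial (MvPolynomial σ ℤ),
      (G.natDegree ≤ e ∧ G.coeff e = a ∧
        ∀ N ∈ 𝒩, Polynomial.C (p ^ k) ∣ g N - G.map (eval N)) ∧
      (H.natDegree ≤ e' ∧ H.coeff e' = a ∧
        ∀ N ∈ 𝒩, Polynomial.C (p ^ k) ∣ h N - H.map (eval N)) := by
  obtain ⟨g₀, hg₀, hg₀e, hgg₀⟩ := exists_monic_congr (hg N₀ hN₀) (hga N₀ hN₀) hβ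
  obtain ⟨h₀, hh₀, hh₀e, hhh₀⟩ := exists_monic_congr (hh N₀ hN₀) (hha N₀ hN₀) hβ
  have base : ∀ {e : ℕ} {g : (σ → ℤ) → Polynomial ℤ}, (∀ N ∈ 𝒩, (g N).natDegree ≤ e) →
      (∀ N ∈ 𝒩, (g N).coeff e = eval N a) → (∀ N ∈ 𝒩, Polynomial.C p ∣ g N - g N₀) →
      ∃ G : Polynomial (MvPolynomial σ ℤ), G.natDegree ≤ e ∧ G.coeff e = a ∧
        ∀ N ∈ 𝒩, Polynomial.C (p ^ 1) ∣ g N - G.map (eval N) := by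
    intro e g hg hga hgN
    refine ⟨(g N₀).map C + Polynomial.C (a - C (eval N₀ a)) * Polynomial.X ^ e, ?_, ?_, ?_⟩
    · refine Polynomial.natDegree_add_le_of_degree_le
        (Polynomial.natDegree_map_le.trans (hg N₀ hN₀)) (Polynomial.natDegree_C_mul_X_pow_le _ _)
    · rw [Polynomial.coeff_add, Polynomial.coeff_map, hga N₀ hN₀, Polynomial.coeff_C_mul_X_pow,
        if_pos rfl, add_sub_cancel]
    · intro N hN
      rw [Polynomial.map_add, map_eval_map_C, pow_one, ← sub_sub]
      refine dvd_sub (hgN N hN) ?_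
      simp only [Polynomial.map_mul, Polynomial.map_C, Polynomial.map_pow, Polynomial.map_X]
      refine Dvd.dvd.mul_right (map_dvd Polynomial.C ?_) _
      have := (Polynomial.C_dvd_iff_dvd_coeff _ _).1 (hgN N hN) e
      rw [Polynomial.coeff_sub, hga N hN, hga N₀ hN₀] at this
      simpa using this
  induction k, hk using Nat.le_induction with
  | base =>
    obtain ⟨G, hG⟩ := base hg hga hgN
    obtain ⟨H, hH⟩ := base hh hha hhN
    exact ⟨G, H, hG, hH⟩
  | succ k hk ih =>
    obtain ⟨G, H, ⟨hG, hGa, hgG⟩, ⟨hH, hHa, hhH⟩⟩ := ih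
    have hred : ∀ {g : (σ → ℤ) → Polynomial ℤ} {g₀ : Polynomial ℤ},
        (∀ N ∈ 𝒩, Polynomial.C p ∣ g N - g N₀) →
        Polynomial.C p ∣ g N₀ - Polynomial.C (eval N₀ a) * g₀ →
        ∀ N ∈ 𝒩, Polynomial.C p ∣ g N - Polynomial.C (eval N₀ a) * g₀ := by
      intro g g₀ h1 h2 N hN
      have := dvd_add (h1 N hN) h2
      rwa [sub_add_sub_cancel] at this
    have hinv : ∀ {g h : (σ → ℤ) → Polynomial ℤ} {g₀ s t : Polynomial ℤ},
        (∀ N ∈ 𝒩, Polynomial.C p ∣ h N - h N₀) →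
        Polynomial.C p ∣ g N₀ - Polynomial.C (eval N₀ a) * g₀ →
        Polynomial.C p ∣ s * g N₀ + t * h N₀ - 1 →
        ∀ N ∈ 𝒩, Polynomial.C p ∣ t * h N - 1 - (-(s * Polynomial.C (eval N₀ a))) * g₀ := by
      intro g h g₀ s t h1 h2 h3 N hN
      have := dvd_sub (dvd_add (Dvd.dvd.mul_left (h1 N hN) t) h3) (Dvd.dvd.mul_left h2 s)
      convert this using 1
      ring
    obtain ⟨G', hG'⟩ := exists_hensel_step hk hp hgh hg hga hG hGa hgG hhH hg₀ hg₀e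
      (hred hgN hgg₀) (hinv hhN hgg₀ hst)
    obtain ⟨H', hH'⟩ := exists_hensel_step hk hp (fun N hN => by rw [mul_comm]; exact hgh N hN)
      hh hha hH hHa hhH hgG hh₀ hh₀e (hred hhN hhh₀)
      (hinv hgN hhh₀ (by rwa [add_comm (t * h N₀)]))
    exact ⟨G', H', hG', hH'⟩

theorem totalDegree_eval₂Hom_le {σ τ R S : Type*} [CommSemiring R] [CommSemiring S]
    (f : R →+* MvPolynomial τ S) (hf : ∀ x, (f x).totalDegree = 0) (g : σ → MvPolynomial τ S)
    (hg : ∀ i, (g i).totalDegree ≤ 1) (Q : MvPolynomial σ R) :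
    (eval₂Hom f g Q).totalDegree ≤ Q.totalDegree := by
  rw [coe_eval₂Hom, eval₂_eq]
  refine totalDegree_finsetSum_le fun d hd => ?_
  refine (totalDegree_mul _ _).trans ?_
  rw [hf, zero_add]
  refine (totalDegree_finsetProd _ _).trans ?_
  refine le_trans ?_ (le_totalDegree hd)
  refine Finset.sum_le_sum fun i _ => (totalDegree_pow _ _).trans ?_
  simpa using Nat.mul_le_mul_left (d i) (hg i)

/-- The substitution `X i ↦ N i + p * X i`. -/
noncomputable def affineHom {σ : Type*} (N : σ → ℤ) (p : ℤ) :
    MvPolynomial σ ℤ →+* MvPolynomial σ ℚ :=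
  eval₂Hom (C.comp (Int.castRingHom ℚ)) fun i => C (N i : ℚ) + C (p : ℚ) * X i

theorem affineHom_X {σ : Type*} (N : σ → ℤ) (p : ℤ) (i : σ) :
    affineHom N p (X i) = C (N i : ℚ) + C (p : ℚ) * X i := by
  rw [affineHom, eval₂Hom_X']

theorem totalDegree_affineHom_le {σ : Type*} (N : σ → ℤ) (p : ℤ) (Q : MvPolynomial σ ℤ) :
    (affineHom N p Q).totalDegree ≤ Q.totalDegree := by
  refine totalDegree_eval₂Hom_le _ (fun x => by rw [RingHom.comp_apply, totalDegree_C]) _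
    (fun i => ?_) Q
  refine (totalDegree_add _ _).trans (max_le ?_ ((totalDegree_mul _ _).trans ?_))
  · rw [totalDegree_C]
    exact Nat.zero_le _
  · rw [totalDegree_C, totalDegree_X]

theorem eval_affineHom {σ : Type*} (N : σ → ℤ) (p : ℤ) (Q : MvPolynomial σ ℤ) (s : σ → ℤ) :
    eval (fun i => (s i : ℚ)) (affineHom N p Q) = (eval (fun i => N i + p * s i) Q : ℤ) := by
  have : (eval (fun i => (s i : ℚ))).comp (affineHom N p) =
      (Int.castRingHom ℚ).comp (eval fun i => N i + p * s i) := by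
    refine MvPolynomial.ringHom_ext (fun x => ?_) fun i => ?_ <;> simp [affineHom]
  exact RingHom.congr_fun this Q

theorem exists_ringHom_comp_affineHom {σ : Type*} (K : Type*) [Field K]
    [Algebra (MvPolynomial σ ℤ) K] [IsFractionRing (MvPolynomial σ ℤ) K] (N : σ → ℤ) {p : ℤ}
    (hp : p ≠ 0) :
    ∃ ψ : MvPolynomial σ ℚ →+* K, ψ.comp (affineHom N p) = algebraMap (MvPolynomial σ ℤ) K := by
  have hinj := IsFractionRing.injective (MvPolynomial σ ℤ) K
  have : CharZero K := by
    refine charZero_of_injective_ringHom (f := (algebraMap (MvPolynomial σ ℤ) K).comp C) ?_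
    exact hinj.comp (C_injective _ _)
  refine ⟨eval₂Hom (Rat.castHom K) fun i => (algebraMap (MvPolynomial σ ℤ) K (X i) - N i) / p, ?_⟩
  have hpK : (p : K) ≠ 0 := Int.cast_ne_zero.2 hp
  refine MvPolynomial.ringHom_ext (fun x => ?_) fun i => ?_
  · simp [affineHom]
  · rw [RingHom.comp_apply, affineHom_X, map_add, map_mul, eval₂Hom_C, eval₂Hom_C, eval₂Hom_X',
      map_intCast, map_intCast]
    field_simp
    ring

theorem not_factor_affineHom {σ : Type*} {F : Polynomial (MvPolynomial σ ℤ)} (K : Type*) [Field K]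
    [Algebra (MvPolynomial σ ℤ) K] [IsFractionRing (MvPolynomial σ ℤ) K]
    (hF : Irreducible (F.map (algebraMap (MvPolynomial σ ℤ) K))) {a : MvPolynomial σ ℤ}
    (ha : a ≠ 0) {e e' : ℕ} (he : 1 ≤ e) (he' : 1 ≤ e') {p : ℤ} (hp : p ≠ 0) (N : σ → ℤ)
    {G H : Polynomial (MvPolynomial σ ℚ)} (hGe : G.coeff e = affineHom N p a)
    (hHe : H.coeff e' = affineHom N p a)
    (hGH : G * H = (Polynomial.C a * F).map (affineHom N p)) : False := by
  obtain ⟨ψ, hψ⟩ := exists_ringHom_comp_affineHom K N hp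
  have haK : algebraMap (MvPolynomial σ ℤ) K a ≠ 0 :=
    (map_ne_zero_iff _ (IsFractionRing.injective _ K)).2 ha
  have hψa : ψ (affineHom N p a) ≠ 0 := by
    rw [← RingHom.comp_apply, hψ]; exact haK
  have hdeg : ∀ {e : ℕ} {G : Polynomial (MvPolynomial σ ℚ)}, 1 ≤ e →
      G.coeff e = affineHom N p a → ¬ IsUnit (G.map ψ) := by
    intro e G he hGe hu
    have h1 : e ≤ (G.map ψ).natDegree :=
      Polynomial.le_natDegree_of_ne_zero (by rwa [Polynomial.coeff_map, hGe])
    rw [Polynomial.natDegree_eq_zero_of_isUnit hu] at h1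
    omega
  have h2 : G.map ψ * H.map ψ =
      Polynomial.C (algebraMap _ K a) * F.map (algebraMap (MvPolynomial σ ℤ) K) := by
    rw [← Polynomial.map_mul, hGH, Polynomial.map_map, hψ, Polynomial.map_mul, Polynomial.map_C]
  have h3 : Irreducible (G.map ψ * H.map ψ) := by
    rw [h2, irreducible_isUnit_mul (Polynomial.isUnit_C.2 haK.isUnit)]
    exact hF
  rcases h3.isUnit_or_isUnit rfl with h | h
  · exact hdeg he hGe h
  · exact hdeg he' hHe h

theorem card_zeros_mul_le {n : ℕ} {R : Type*} [CommRing R] [IsDomain R] [DecidableEq R]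
    {Q : MvPolynomial (Fin n) R} (hQ : Q ≠ 0) (A : Finset R) :
    ((Fintype.piFinset fun _ : Fin n => A).filter fun x => eval x Q = 0).card * A.card ≤
      Q.totalDegree * A.card ^ n := by
  have h := schwartz_zippel_totalDegree hQ A
  rcases Nat.eq_zero_or_pos A.card with h0 | h0
  · rw [h0]
    simp
  · have h0' : (0 : ℚ≥0) < A.card := by exact_mod_cast h0
    rw [div_le_div_iff₀ (by positivity) h0'] at h
    exact_mod_cast h

theorem exists_totalDegree_coeff_le {σ R : Type*} [CommSemiring R]
    (F : Polynomial (MvPolynomial σ R)) : ∃ d, ∀ j, (F.coeff j).totalDegree ≤ d := by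
  refine ⟨F.support.sup fun j => (F.coeff j).totalDegree, fun j => ?_⟩
  by_cases hj : j ∈ F.support
  · exact Finset.le_sup (f := fun j => (F.coeff j).totalDegree) hj
  · rw [Polynomial.notMem_support_iff.1 hj, totalDegree_zero]
    exact Nat.zero_le _

theorem totalDegree_coeff_mul_le {σ R : Type*} [CommSemiring R]
    {F G : Polynomial (MvPolynomial σ R)} {d d' : ℕ} (hF : ∀ j, (F.coeff j).totalDegree ≤ d)
    (hG : ∀ j, (G.coeff j).totalDegree ≤ d') (j : ℕ) :
    ((F * G).coeff j).totalDegree ≤ d + d' := by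
  rw [Polynomial.coeff_mul]
  exact totalDegree_finsetSum_le fun x _ =>
    (totalDegree_mul _ _).trans (Nat.add_le_add (hF _) (hG _))

/-- A family of polynomials with small coefficients which are polynomial in the parameter modulo
`p ^ k` has coefficients which are rational polynomials of bounded degree in the parameter. -/
theorem exists_interpolated_family {n : ℕ} (W : Finset (Fin n → ℤ)) (k : ℕ) :
    ∃ C₀ : ℕ, ∀ S ⊆ W, ∀ (p Z e : ℕ) (N₀ : Fin n → ℤ) (a : MvPolynomial (Fin n) ℤ)
      (g : (Fin n → ℤ) → Polynomial ℤ) (G : Polynomial (MvPolynomial (Fin n) ℤ)),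
      C₀ * Z < p ^ k → (∀ s ∈ S, ∀ j, |(g s).coeff j| ≤ Z) →
      (∀ s ∈ S, (g s).natDegree ≤ e) →
      (∀ s ∈ S, (g s).coeff e = eval (fun i => N₀ i + p * s i) a) →
      (∀ s ∈ S, Polynomial.C ((p : ℤ) ^ k) ∣ g s - G.map (eval fun i => N₀ i + p * s i)) →
      ∃ 𝒢 : Polynomial (MvPolynomial (Fin n) ℚ), 𝒢.coeff e = affineHom N₀ p a ∧
        (∀ j, (𝒢.coeff j).totalDegree ≤ k * n + a.totalDegree) ∧
        ∀ s ∈ S, 𝒢.map (eval fun i => (s i : ℚ)) = (g s).map (Int.castRingHom ℚ) := by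
  obtain ⟨C₀, hC₀⟩ := exists_interpolation W k
  refine ⟨C₀, fun S hS p Z e N₀ a g G hZ hgZ hge hga hgG => ?_⟩
  have hq : ∀ j, ∃ q : MvPolynomial (Fin n) ℚ, q.totalDegree ≤ k * n ∧
      ∀ s ∈ S, ((g s).coeff j : ℚ) = eval (fun i => (s i : ℚ)) q := by
    intro j
    obtain ⟨c, hc⟩ := exists_boxPoly_congr (G.coeff j) N₀ (p : ℤ) k
    obtain ⟨q, hq⟩ := hC₀ S hS (fun s => (g s).coeff j) (p ^ k) Z (fun s hs => hgZ s hs j) hZ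
      ⟨c, fun s hs => by
        have h1 := (Polynomial.C_dvd_iff_dvd_coeff _ _).1 (hgG s hs) j
        rw [Polynomial.coeff_sub, Polynomial.coeff_map] at h1
        have h2 := dvd_add h1 (hc s)
        rw [sub_add_sub_cancel] at h2
        exact_mod_cast h2⟩
    refine ⟨q, ?_, hq.2⟩
    simpa using hq.1
  choose q hqd hq using hq
  have hcoeff : ∀ j, (∑ i ∈ Finset.range e, Polynomial.C (q i) * Polynomial.X ^ i +
      Polynomial.C (affineHom N₀ p a) * Polynomial.X ^ e).coeff j =
      if j < e then q j else if j = e then affineHom N₀ p a else 0 := by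
    intro j
    rw [Polynomial.coeff_add, Polynomial.finsetSum_coeff, Polynomial.coeff_C_mul_X_pow]
    simp only [Polynomial.coeff_C_mul_X_pow, Finset.sum_ite_eq, Finset.mem_range]
    split_ifs with h1 h2
    · omega
    · simp
    · simp
    · simp
  refine ⟨_, by rw [hcoeff, if_neg (lt_irrefl e), if_pos rfl], fun j => ?_, fun s hs => ?_⟩
  · rw [hcoeff]
    split_ifs
    · exact (hqd j).trans (Nat.le_add_right _ _)
    · exact (totalDegree_affineHom_le _ _ _).trans (Nat.le_add_left _ _)
    · rw [totalDegree_zero]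
      exact Nat.zero_le _
  · ext j
    rw [Polynomial.coeff_map, hcoeff, Polynomial.coeff_map, eq_intCast]
    split_ifs with h1 h2
    · rw [hq j s hs]
    · rw [h2, hga s hs, eval_affineHom]
    · rw [map_zero, Polynomial.coeff_eq_zero_of_natDegree_lt ((hge s hs).trans_lt (by omega)),
        Int.cast_zero]

theorem exists_card_fiber_le {n : ℕ} {F : Polynomial (MvPolynomial (Fin n) ℤ)} (K : Type*)
    [Field K] [Algebra (MvPolynomial (Fin n) ℤ) K] [IsFractionRing (MvPolynomial (Fin n) ℤ) K]
    (hF : Irreducible (F.map (algebraMap (MvPolynomial (Fin n) ℤ) K)))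
    {a : MvPolynomial (Fin n) ℤ} (ha : a ≠ 0) {k : ℕ} (hk : 1 ≤ k) :
    ∃ D : ℕ, ∀ A : Finset ℤ, ∃ C₀ : ℕ, ∀ S ⊆ Fintype.piFinset fun _ : Fin n => A,
      ∀ (p Z e e' : ℕ) (N₀ : Fin n → ℤ) (g h : (Fin n → ℤ) → Polynomial ℤ),
      p ≠ 0 → 1 ≤ e → 1 ≤ e' → C₀ * Z < p ^ k →
      (∀ s ∈ S, g s * h s = (Polynomial.C a * F).map (eval fun i => N₀ i + p * s i)) →
      (∀ s ∈ S, ∀ j, |(g s).coeff j| ≤ Z) → (∀ s ∈ S, ∀ j, |(h s).coeff j| ≤ Z) →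
      (∀ s ∈ S, (g s).natDegree ≤ e) → (∀ s ∈ S, (h s).natDegree ≤ e') →
      (∀ s ∈ S, (g s).coeff e = eval (fun i => N₀ i + p * s i) a) →
      (∀ s ∈ S, (h s).coeff e' = eval (fun i => N₀ i + p * s i) a) →
      (∀ s ∈ S, ∀ t ∈ S, Polynomial.C (p : ℤ) ∣ g s - g t) →
      (∀ s ∈ S, ∀ t ∈ S, Polynomial.C (p : ℤ) ∣ h s - h t) →
      (∀ s ∈ S, ∃ β, (p : ℤ) ∣ eval (fun i => N₀ i + p * s i) a * β - 1) →
      (∀ s ∈ S, ∃ u v, Polynomial.C (p : ℤ) ∣ u * g s + v * h s - 1) →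
      S.card * A.card ≤ D * A.card ^ n := by
  obtain ⟨d, hd⟩ := exists_totalDegree_coeff_le (Polynomial.C a * F)
  refine ⟨(k * n + a.totalDegree) + (k * n + a.totalDegree) + d, fun A => ?_⟩
  obtain ⟨C₀, hC₀⟩ := exists_interpolated_family (Fintype.piFinset fun _ : Fin n => A) k
  refine ⟨C₀, fun S hS p Z e e' N₀ g h hp he he' hZ hgh hgZ hhZ hge hhe hga hha hgp hhp hβ huv =>
    ?_⟩
  rcases S.eq_empty_or_nonempty with rfl | ⟨s₀, hs₀⟩
  · simp
  have hp' : (p : ℤ) ≠ 0 := by exact_mod_cast hp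
  set pt : (Fin n → ℤ) → (Fin n → ℤ) := fun s i => N₀ i + p * s i with hpt
  have hptinj : Function.Injective pt := by
    intro s t hst
    funext i
    have := congrFun hst i
    simpa [hpt, hp] using this
  obtain ⟨β, hβ⟩ := hβ s₀ hs₀
  obtain ⟨u, v, huv⟩ := huv s₀ hs₀
  have hinv : ∀ s, Function.invFun pt (pt s) = s := Function.leftInverse_invFun hptinj
  obtain ⟨G, H, ⟨-, -, hG⟩, -, -, hH⟩ := exists_hensel_family hp' (𝒩 := pt '' S)
    (Φ := Polynomial.C a * F) (a := a) (g := fun N => g (Function.invFun pt N))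
    (h := fun N => h (Function.invFun pt N)) (s := u) (t := v) (β := β)
    (e := e) (e' := e') (Set.mem_image_of_mem pt hs₀)
    (Set.forall_mem_image.2 fun s hs => by simpa only [hinv] using hgh s hs)
    (Set.forall_mem_image.2 fun s hs => by simpa only [hinv] using hge s hs)
    (Set.forall_mem_image.2 fun s hs => by simpa only [hinv] using hga s hs)
    (Set.forall_mem_image.2 fun s hs => by simpa only [hinv] using hhe s hs)
    (Set.forall_mem_image.2 fun s hs => by simpa only [hinv] using hha s hs)
    (Set.forall_mem_image.2 fun s hs => by simpa only [hinv] using hgp s hs s₀ hs₀)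
    (Set.forall_mem_image.2 fun s hs => by simpa only [hinv] using hhp s hs s₀ hs₀)
    (by simpa only [hinv] using hβ) (by simpa only [hinv] using huv) hk
  rw [Set.forall_mem_image] at hG hH
  simp only [hinv] at hG hH
  obtain ⟨𝒢, h𝒢a, h𝒢d, h𝒢⟩ := hC₀ S hS p Z e N₀ a g G hZ hgZ hge hga fun s hs => hG hs
  obtain ⟨ℋ, hℋa, hℋd, hℋ⟩ := hC₀ S hS p Z e' N₀ a h H hZ hhZ hhe hha fun s hs => hH hs
  have hne : 𝒢 * ℋ ≠ (Polynomial.C a * F).map (affineHom N₀ p) := fun heq =>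
    not_factor_affineHom K hF ha he he' hp' N₀ h𝒢a hℋa heq
  have hne' : ∃ j, (𝒢 * ℋ - (Polynomial.C a * F).map (affineHom N₀ p)).coeff j ≠ 0 := by
    by_contra hcon
    push Not at hcon
    exact hne (sub_eq_zero.1 (Polynomial.ext fun j => by rw [hcon j, Polynomial.coeff_zero]))
  obtain ⟨j, hj⟩ := hne'
  set Q := (𝒢 * ℋ - (Polynomial.C a * F).map (affineHom N₀ p)).coeff j with hQ
  have hQd : Q.totalDegree ≤ (k * n + a.totalDegree) + (k * n + a.totalDegree) + d := by
    rw [hQ, Polynomial.coeff_sub, Polynomial.coeff_map]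
    refine (totalDegree_sub _ _).trans (max_le ?_ ?_)
    · exact (totalDegree_coeff_mul_le h𝒢d hℋd j).trans (Nat.le_add_right _ _)
    · exact (totalDegree_affineHom_le _ _ _).trans ((hd j).trans (Nat.le_add_left _ _))
  have hzero : ∀ s ∈ S, eval (fun i => (s i : ℚ)) Q = 0 := by
    intro s hs
    rw [hQ, ← Polynomial.coeff_map, Polynomial.map_sub, Polynomial.map_mul, h𝒢 s hs, hℋ s hs,
      ← Polynomial.map_mul, hgh s hs, Polynomial.coeff_sub, Polynomial.coeff_map,
      Polynomial.coeff_map, Polynomial.coeff_map, Polynomial.coeff_map, eval_affineHom, eq_intCast,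
      sub_self]
  have hcard := card_zeros_mul_le hj (A.map ⟨_, Int.cast_injective (α := ℚ)⟩)
  rw [Finset.card_map] at hcard
  refine le_trans (Nat.mul_le_mul_right _ ?_) (hcard.trans (Nat.mul_le_mul_right _ hQd))
  refine Finset.card_le_card_of_injOn (fun s i => (s i : ℚ)) (fun s hs => ?_) ?_
  · have := Fintype.mem_piFinset.1 (hS hs)
    simp only [Finset.coe_filter, Set.mem_ofPred_eq, Fintype.mem_piFinset, Finset.mem_map,
      Function.Embedding.coeFn_mk]
    exact ⟨fun i => ⟨s i, this i, rfl⟩, hzero s hs⟩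
  · intro s _ t _ hst
    funext i
    exact Int.cast_injective (congrFun hst i)

theorem exists_finset_divisors {k : Type*} [Field k] {f : Polynomial k} (hf : f ≠ 0) (a : k) :
    ∃ T : Finset (Polynomial k), T.card ≤ 2 ^ f.natDegree ∧
      ∀ u, u ∣ f → u.leadingCoeff = a → u ∈ T := by
  classical
  set ι := algebraMap k (AlgebraicClosure k)
  have hfι : f.map ι ≠ 0 := Polynomial.map_ne_zero hf
  set Y : Set (Polynomial k) := {u | u ∣ f ∧ u.leadingCoeff = a}
  have hmaps : Set.MapsTo (fun u : Polynomial k => (u.map ι).roots) Y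
      ((f.map ι).roots.powerset.toFinset : Set (Multiset (AlgebraicClosure k))) := by
    intro u hu
    simp only [Finset.mem_coe, Multiset.mem_toFinset, Multiset.mem_powerset]
    exact Polynomial.roots.le_of_dvd hfι (Polynomial.map_dvd ι hu.1)
  have hinj : Set.InjOn (fun u : Polynomial k => (u.map ι).roots) Y := by
    intro u hu v hv huv
    refine Polynomial.map_injective ι ι.injective ?_
    rw [(IsAlgClosed.splits (u.map ι)).eq_prod_roots, (IsAlgClosed.splits (v.map ι)).eq_prod_roots,
      Polynomial.leadingCoeff_map, Polynomial.leadingCoeff_map, hu.2, hv.2]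
    simp only at huv
    rw [huv]
  have hfin : Y.Finite := Set.Finite.of_injOn hmaps hinj (Finset.finite_toSet _)
  refine ⟨hfin.toFinset, ?_, fun u hu hua => hfin.mem_toFinset.2 ⟨hu, hua⟩⟩
  have h1 := Finset.card_le_card_of_injOn (s := hfin.toFinset)
    (t := (f.map ι).roots.powerset.toFinset) (fun u : Polynomial k => (u.map ι).roots)
    (by rwa [Set.Finite.coe_toFinset]) (by rwa [Set.Finite.coe_toFinset])
  refine h1.trans ((Multiset.toFinset_card_le _).trans ?_)
  rw [Multiset.card_powerset]
  refine Nat.pow_le_pow_right two_pos ((Polynomial.card_roots' _).trans ?_)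
  exact Polynomial.natDegree_map_le

theorem C_dvd_iff_map_eq_zero (p : ℕ) (f : Polynomial ℤ) :
    Polynomial.C (p : ℤ) ∣ f ↔ f.map (Int.castRingHom (ZMod p)) = 0 := by
  rw [Polynomial.C_dvd_iff_dvd_coeff, Polynomial.ext_iff]
  refine forall_congr' fun j => ?_
  rw [Polynomial.coeff_map, Polynomial.coeff_zero, eq_intCast, ZMod.intCast_zmod_eq_zero_iff_dvd]

theorem C_dvd_sub_iff_map_eq (p : ℕ) (f g : Polynomial ℤ) :
    Polynomial.C (p : ℤ) ∣ f - g ↔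
      f.map (Int.castRingHom (ZMod p)) = g.map (Int.castRingHom (ZMod p)) := by
  rw [C_dvd_iff_map_eq_zero, Polynomial.map_sub, sub_eq_zero]

/-- In a residue class modulo `p` where `F` stays separable there are few points, the scaled
specialization at which factors with small coefficients. -/
theorem exists_card_class_le {n : ℕ} {F : Polynomial (MvPolynomial (Fin n) ℤ)} (K : Type*)
    [Field K] [Algebra (MvPolynomial (Fin n) ℤ) K] [IsFractionRing (MvPolynomial (Fin n) ℤ) K]
    (hF : Irreducible (F.map (algebraMap (MvPolynomial (Fin n) ℤ) K)))
    {a Δ : MvPolynomial (Fin n) ℤ} (ha : a ≠ 0) {U V : Polynomial (MvPolynomial (Fin n) ℤ)}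
    (hΔ : U * F + V * Polynomial.derivative F = Polynomial.C Δ) {k : ℕ} (hk : 1 ≤ k) :
    ∃ D : ℕ, ∀ A : Finset ℤ, ∃ C₀ : ℕ, ∀ S ⊆ Fintype.piFinset fun _ : Fin n => A,
      ∀ (p Z : ℕ) (N₀ : Fin n → ℤ), p.Prime → C₀ * Z < p ^ k → ¬ (p : ℤ) ∣ eval N₀ (a * Δ) →
      (∀ s ∈ S, ∃ g h : Polynomial ℤ, 1 ≤ g.natDegree ∧ 1 ≤ h.natDegree ∧
        g * h = (Polynomial.C a * F).map (eval fun i => N₀ i + p * s i) ∧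
        g.leadingCoeff = eval (fun i => N₀ i + p * s i) a ∧
        h.leadingCoeff = eval (fun i => N₀ i + p * s i) a ∧
        (∀ j, |g.coeff j| ≤ Z) ∧ ∀ j, |h.coeff j| ≤ Z) →
      S.card * A.card ≤ D * A.card ^ n := by
  classical
  obtain ⟨D, hD⟩ := exists_card_fiber_le K hF ha hk
  refine ⟨2 ^ F.natDegree * D, fun A => ?_⟩
  obtain ⟨C₀, hC₀⟩ := hD A
  refine ⟨C₀, fun S hS p Z N₀ hp hZ hpaΔ hgh => ?_⟩
  have : Fact p.Prime := ⟨hp⟩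
  choose! g h hg1 hh1 hmul hgl hhl hgZ hhZ using hgh
  set ρ := Int.castRingHom (ZMod p)
  set φ := ρ.comp (eval N₀)
  have hφ : ∀ s : Fin n → ℤ, ρ.comp (eval fun i => N₀ i + p * s i) = φ := by
    intro s
    refine MvPolynomial.ringHom_ext (fun x => ?_) fun i => ?_ <;> simp [φ, ρ]
  have hφ' : ∀ (s : Fin n → ℤ) (Q : MvPolynomial (Fin n) ℤ),
      ρ (eval (fun i => N₀ i + p * s i) Q) = φ Q := fun s Q => by rw [← hφ s]; rfl
  have hφaΔ : φ a * φ Δ ≠ 0 := by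
    rw [← map_mul]
    intro h0
    exact hpaΔ ((ZMod.intCast_zmod_eq_zero_iff_dvd _ p).1 h0)
  have hφa := left_ne_zero_of_mul hφaΔ
  have hφΔ := right_ne_zero_of_mul hφaΔ
  have hsepF : (F.map φ).Separable := by
    refine ⟨Polynomial.C (φ Δ)⁻¹ * U.map φ, Polynomial.C (φ Δ)⁻¹ * V.map φ, ?_⟩
    rw [Polynomial.derivative_map, mul_assoc, mul_assoc, ← mul_add, ← Polynomial.map_mul,
      ← Polynomial.map_mul, ← Polynomial.map_add, hΔ, Polynomial.map_C, ← Polynomial.C_mul,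
      inv_mul_cancel₀ hφΔ, Polynomial.C_1]
  have hsep : ((Polynomial.C a * F).map φ).Separable := by
    rw [Polynomial.map_mul, Polynomial.map_C]
    exact Polynomial.Separable.unit_mul (Polynomial.isUnit_C.2 hφa.isUnit) hsepF
  have hmul' : ∀ s ∈ S, (g s).map ρ * (h s).map ρ = (Polynomial.C a * F).map φ := by
    intro s hs
    rw [← Polynomial.map_mul, hmul s hs, Polynomial.map_map, hφ]
  have hlead : ∀ f : Polynomial ℤ, ρ f.leadingCoeff = φ a →
      (f.map ρ).natDegree = f.natDegree ∧ (f.map ρ).leadingCoeff = φ a := by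
    intro f hf
    have h0 : ρ f.leadingCoeff ≠ 0 := by rwa [hf]
    exact ⟨Polynomial.natDegree_map_of_leadingCoeff_ne_zero _ h0,
      by rw [Polynomial.leadingCoeff_map_of_leadingCoeff_ne_zero _ h0, hf]⟩
  obtain ⟨T, hTcard, hT⟩ := exists_finset_divisors hsep.ne_zero (φ a)
  have hTcard' : T.card ≤ 2 ^ F.natDegree := by
    refine hTcard.trans (Nat.pow_le_pow_right two_pos (Polynomial.natDegree_map_le.trans ?_))
    exact Polynomial.natDegree_C_mul_le _ _
  have hmaps : ∀ s ∈ S, (g s).map ρ ∈ T := fun s hs =>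
    hT _ ⟨_, (hmul' s hs).symm⟩ (hlead _ (by rw [hgl s hs, hφ'])).2
  have hfiber : ∀ u ∈ T, (S.filter fun s => (g s).map ρ = u).card * A.card ≤ D * A.card ^ n := by
    intro u _
    rcases (S.filter fun s => (g s).map ρ = u).eq_empty_or_nonempty with h0 | ⟨s₀, hs₀⟩
    · rw [h0]
      simp
    obtain ⟨hs₀, hs₀u⟩ := Finset.mem_filter.1 hs₀
    have hge : ∀ s ∈ S.filter fun s => (g s).map ρ = u, (g s).natDegree = (g s₀).natDegree := by
      intro s hs
      obtain ⟨hs, hsu⟩ := Finset.mem_filter.1 hs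
      rw [← (hlead (g s) (by rw [hgl s hs, hφ'])).1, ← (hlead (g s₀) (by rw [hgl s₀ hs₀, hφ'])).1,
        hsu, hs₀u]
    have hmaph : ∀ s ∈ S.filter fun s => (g s).map ρ = u, (h s).map ρ = (h s₀).map ρ := by
      intro s hs
      obtain ⟨hs, hsu⟩ := Finset.mem_filter.1 hs
      have hu0 : u ≠ 0 := by
        intro hu0
        apply hsep.ne_zero
        rw [← hmul' s hs, hsu, hu0, zero_mul]
      refine mul_left_cancel₀ hu0 ?_
      conv_lhs => rw [← hsu]
      conv_rhs => rw [← hs₀u]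
      rw [hmul' s hs, hmul' s₀ hs₀]
    have hhe : ∀ s ∈ S.filter fun s => (g s).map ρ = u, (h s).natDegree = (h s₀).natDegree := by
      intro s hs
      have hsS := (Finset.mem_filter.1 hs).1
      rw [← (hlead (h s) (by rw [hhl s hsS, hφ'])).1,
        ← (hlead (h s₀) (by rw [hhl s₀ hs₀, hφ'])).1, hmaph s hs]
    refine hC₀ _ ((Finset.filter_subset _ _).trans hS) p Z (g s₀).natDegree (h s₀).natDegree N₀ g h
      hp.ne_zero (hg1 s₀ hs₀) (hh1 s₀ hs₀) hZ
      (fun s hs => hmul s (Finset.mem_filter.1 hs).1) (fun s hs => hgZ s (Finset.mem_filter.1 hs).1)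
      (fun s hs => hhZ s (Finset.mem_filter.1 hs).1) (fun s hs => (hge s hs).le)
      (fun s hs => (hhe s hs).le) (fun s hs => ?_) (fun s hs => ?_) (fun s hs t ht => ?_)
      (fun s hs t ht => ?_) (fun s hs => ?_) (fun s hs => ?_)
    · rw [← hge s hs]
      exact hgl s (Finset.mem_filter.1 hs).1
    · rw [← hhe s hs]
      exact hhl s (Finset.mem_filter.1 hs).1
    · rw [C_dvd_sub_iff_map_eq]
      exact (Finset.mem_filter.1 hs).2.trans (Finset.mem_filter.1 ht).2.symm
    · rw [C_dvd_sub_iff_map_eq]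
      exact (hmaph s hs).trans (hmaph t ht).symm
    · obtain ⟨β, hβ⟩ := ZMod.intCast_surjective (φ a)⁻¹
      refine ⟨β, (ZMod.intCast_zmod_eq_zero_iff_dvd _ p).1 ?_⟩
      have : ((eval (fun i => N₀ i + p * s i) a : ℤ) : ZMod p) = φ a := hφ' s a
      rw [Int.cast_sub, Int.cast_mul, this, hβ, mul_inv_cancel₀ hφa, Int.cast_one, sub_self]
    · have hsS := (Finset.mem_filter.1 hs).1
      have hcop : IsCoprime ((g s).map ρ) ((h s).map ρ) := by
        refine Polynomial.Separable.isCoprime ?_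
        rw [hmul' s hsS]
        exact hsep
      obtain ⟨u', v', huv⟩ := hcop
      obtain ⟨u, rfl⟩ := Polynomial.map_surjective ρ (ZMod.intCast_surjective) u'
      obtain ⟨v, rfl⟩ := Polynomial.map_surjective ρ (ZMod.intCast_surjective) v'
      refine ⟨u, v, ?_⟩
      rw [C_dvd_sub_iff_map_eq, Polynomial.map_add, Polynomial.map_mul, Polynomial.map_mul,
        Polynomial.map_one]
      exact huv
  rw [Finset.card_eq_sum_card_fiberwise hmaps, Finset.sum_mul]
  refine (Finset.sum_le_card_nsmul T _ _ hfiber).trans ?_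
  rw [smul_eq_mul, ← mul_assoc]
  gcongr

/-- The integer points of the cube `[-B, B] ^ σ`. -/
noncomputable def box (σ : Type*) [Fintype σ] [DecidableEq σ] (B : ℕ) : Finset (σ → ℤ) :=
  Fintype.piFinset fun _ => Finset.Icc (-(B : ℤ)) B

theorem mem_box {σ : Type*} [Fintype σ] [DecidableEq σ] {B : ℕ} {N : σ → ℤ} :
    N ∈ box σ B ↔ ∀ i, |N i| ≤ B := by
  simp [box, abs_le]

theorem card_Icc_neg (B : ℕ) : (Finset.Icc (-(B : ℤ)) B).card = 2 * B + 1 := by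
  rw [Int.card_Icc]
  omega

theorem card_box (σ : Type*) [Fintype σ] [DecidableEq σ] (B : ℕ) :
    (box σ B).card = (2 * B + 1) ^ Fintype.card σ := by
  rw [box, Fintype.card_piFinset, Finset.prod_const, card_Icc_neg, Finset.card_univ]

theorem exists_abs_eval_le {σ : Type*} (Q : MvPolynomial σ ℤ) :
    ∃ c : ℕ, ∀ B : ℕ, 1 ≤ B → ∀ N : σ → ℤ, (∀ i, |N i| ≤ B) →
      |eval N Q| ≤ c * (B : ℤ) ^ Q.totalDegree := by
  refine ⟨(∑ d ∈ Q.support, |Q.coeff d|).toNat, fun B hB N hN => ?_⟩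
  rw [Int.toNat_of_nonneg (Finset.sum_nonneg fun _ _ => abs_nonneg _), eval_eq, Finset.sum_mul]
  refine (Finset.abs_sum_le_sum_abs _ _).trans (Finset.sum_le_sum fun d hd => ?_)
  rw [abs_mul]
  refine mul_le_mul_of_nonneg_left ?_ (abs_nonneg _)
  rw [Finset.abs_prod]
  have h1 : ∏ i ∈ d.support, |N i ^ d i| ≤ ∏ i ∈ d.support, (B : ℤ) ^ d i :=
    Finset.prod_le_prod (fun _ _ => abs_nonneg _) fun i _ => by
      rw [abs_pow]
      exact pow_le_pow_left₀ (abs_nonneg _) (hN i) _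
  refine h1.trans ?_
  rw [Finset.prod_pow_eq_pow_sum]
  exact pow_le_pow_right₀ (by exact_mod_cast hB) (le_totalDegree hd)

theorem exists_abs_coeff_map_eval_le {σ : Type*} (F : Polynomial (MvPolynomial σ ℤ)) :
    ∃ c d : ℕ, ∀ B : ℕ, 1 ≤ B → ∀ N : σ → ℤ, (∀ i, |N i| ≤ B) → ∀ j,
      |(F.map (eval N)).coeff j| ≤ (c * B ^ d : ℕ) := by
  choose c hc using fun j => exists_abs_eval_le (F.coeff j)
  obtain ⟨d, hd⟩ := exists_totalDegree_coeff_le F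
  refine ⟨∑ j ∈ F.support, c j, d, fun B hB N hN j => ?_⟩
  rw [Polynomial.coeff_map]
  by_cases hj : j ∈ F.support
  · refine (hc j B hB N hN).trans ?_
    have h1 : c j ≤ ∑ j ∈ F.support, c j := Finset.single_le_sum (fun _ _ => Nat.zero_le _) hj
    have h2 : B ^ (F.coeff j).totalDegree ≤ B ^ d := Nat.pow_le_pow_right hB (hd j)
    exact_mod_cast Nat.mul_le_mul h1 h2
  · rw [Polynomial.notMem_support_iff.1 hj, map_zero, abs_zero]
    positivity

theorem abs_coeff_le_of_mul {f g h : Polynomial ℤ} (hgh : g * h = f) (hf : f ≠ 0) {D Z : ℕ}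
    (hD : f.natDegree ≤ D) (hZ : ∀ j, |f.coeff j| ≤ Z) (j : ℕ) :
    |g.coeff j| ≤ (2 ^ D * ((D + 1) * Z) : ℕ) := by
  have hg : g ≠ 0 := by rintro rfl; simp [eq_comm, hf] at hgh
  have hh : h ≠ 0 := by rintro rfl; simp [eq_comm, hf] at hgh
  set ι := Int.castRingHom ℂ
  have h1 := Polynomial.norm_coeff_le_choose_mul_mahlerMeasure_of_one_le_mahlerMeasure j
    (g.map ι) (h.map ι) (Polynomial.one_le_mahlerMeasure_of_ne_zero hh)
  have hdeg : (g.map ι).natDegree ≤ D := by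
    refine Polynomial.natDegree_map_le.trans (le_trans ?_ hD)
    rw [← hgh, Polynomial.natDegree_mul hg hh]
    exact Nat.le_add_right _ _
  have h2 : (((g.map ι).natDegree.choose j : ℕ) : ℝ) ≤ (2 ^ D : ℕ) := by
    exact_mod_cast (Nat.choose_le_two_pow _ _).trans (Nat.pow_le_pow_right two_pos hdeg)
  have h3 : (g.map ι * h.map ι).mahlerMeasure ≤ ((D + 1) * Z : ℕ) := by
    rw [← Polynomial.map_mul, hgh]
    refine (Polynomial.mahlerMeasure_le_sum_norm_coeff _).trans ?_
    rw [Polynomial.sum_over_range' _ (fun _ => norm_zero) (D + 1)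
      (Nat.lt_succ_of_le (Polynomial.natDegree_map_le.trans hD))]
    refine (Finset.sum_le_card_nsmul _ _ (Z : ℝ) fun i _ => ?_).trans ?_
    · rw [Polynomial.coeff_map, eq_intCast, Complex.norm_intCast]
      exact_mod_cast hZ i
    · rw [Finset.card_range, nsmul_eq_mul, Nat.cast_mul]
  have h4 : ‖(g.map ι).coeff j‖ ≤ (2 ^ D : ℕ) * ((D + 1) * Z : ℕ) :=
    h1.trans (mul_le_mul h2 h3 (Polynomial.mahlerMeasure_nonneg _) (by positivity))
  rw [Polynomial.coeff_map, eq_intCast, Complex.norm_intCast] at h4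
  exact_mod_cast h4

theorem exists_card_dvd_eval_mul_le {n : ℕ} {Q : MvPolynomial (Fin n) ℤ} (hQ : Q ≠ 0) :
    ∃ P₀ : ℕ, ∀ p : ℕ, p.Prime → P₀ < p →
      ((Fintype.piFinset fun _ : Fin n => Finset.Ico (0 : ℤ) p).filter
        fun N => (p : ℤ) ∣ eval N Q).card * p ≤ Q.totalDegree * p ^ n := by
  obtain ⟨d, hd⟩ := exists_coeff_ne_zero hQ
  refine ⟨(Q.coeff d).natAbs, fun p hp hpd => ?_⟩
  have : Fact p.Prime := ⟨hp⟩
  set ρ := Int.castRingHom (ZMod p)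
  have hQ' : map ρ Q ≠ 0 := by
    intro h0
    have h1 : ρ (Q.coeff d) = 0 := by rw [← coeff_map, h0, coeff_zero]
    have h2 := (ZMod.intCast_zmod_eq_zero_iff_dvd _ p).1 h1
    exact hd (Int.eq_zero_of_abs_lt_dvd h2 (by rw [Int.abs_eq_natAbs]; exact_mod_cast hpd))
  have h1 := card_zeros_mul_le hQ' (Finset.univ : Finset (ZMod p))
  rw [Finset.card_univ, ZMod.card] at h1
  refine le_trans (Nat.mul_le_mul_right _ ?_) (h1.trans (Nat.mul_le_mul_right _ ?_))
  · refine Finset.card_le_card_of_injOn (fun N i => (N i : ZMod p)) (fun N hN => ?_) ?_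
    · simp only [Finset.coe_filter, Set.mem_ofPred_eq] at hN ⊢
      refine ⟨by simp, ?_⟩
      have h2 : eval (fun i => (N i : ZMod p)) (map ρ Q) = ρ (eval N Q) := by
        have : (eval fun i => (N i : ZMod p)).comp (map ρ) = ρ.comp (eval N) :=
          MvPolynomial.ringHom_ext (fun x => by simp) fun i => by simp [ρ]
        exact RingHom.congr_fun this Q
      rw [h2]
      exact (ZMod.intCast_zmod_eq_zero_iff_dvd _ p).2 hN.2
    · intro N hN M hM hNM
      simp only [Finset.coe_filter, Set.mem_ofPred_eq, Fintype.mem_piFinset, Finset.mem_Ico]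
        at hN hM
      funext i
      have h2 := (ZMod.intCast_eq_intCast_iff_dvd_sub _ _ _).1 (congrFun hNM i)
      have h3 := Int.eq_zero_of_abs_lt_dvd h2 (by
        have := hN.1 i
        have := hM.1 i
        rw [abs_lt]
        omega)
      omega
  · exact Finset.sup_mono (support_map_subset _ _)

/-- A factorization of a specialization can be scaled so that both factors have the expected
leading coefficient. -/
theorem exists_scaled_factors {f g h : Polynomial ℤ} {α : ℤ} (hα : α ≠ 0) (hg : 1 ≤ g.natDegree)
    (hh : 1 ≤ h.natDegree) (hgh : g * h = f) (hf : f.leadingCoeff = α) {D Z : ℕ}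
    (hD : f.natDegree ≤ D) (hZ : ∀ j, |(Polynomial.C α * f).coeff j| ≤ Z) :
    ∃ g' h' : Polynomial ℤ, 1 ≤ g'.natDegree ∧ 1 ≤ h'.natDegree ∧ g' * h' = Polynomial.C α * f ∧
      g'.leadingCoeff = α ∧ h'.leadingCoeff = α ∧
      (∀ j, |g'.coeff j| ≤ (2 ^ D * ((D + 1) * Z) : ℕ)) ∧
      ∀ j, |h'.coeff j| ≤ (2 ^ D * ((D + 1) * Z) : ℕ) := by
  have hlc : g.leadingCoeff * h.leadingCoeff = α := by
    rw [← hf, ← hgh, Polynomial.leadingCoeff_mul]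
  have hg0 : g.leadingCoeff ≠ 0 := left_ne_zero_of_mul (hlc.trans_ne hα)
  have hh0 : h.leadingCoeff ≠ 0 := right_ne_zero_of_mul (hlc.trans_ne hα)
  have hf0 : Polynomial.C α * f ≠ 0 := by
    refine mul_ne_zero (Polynomial.C_ne_zero.2 hα) ?_
    rw [← Polynomial.leadingCoeff_ne_zero, hf]
    exact hα
  have hmul : (Polynomial.C h.leadingCoeff * g) * (Polynomial.C g.leadingCoeff * h) =
      Polynomial.C α * f := by
    rw [← hgh, ← hlc, Polynomial.C_mul]
    ring
  have hD' : (Polynomial.C α * f).natDegree ≤ D := (Polynomial.natDegree_C_mul_le _ _).trans hD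
  refine ⟨Polynomial.C h.leadingCoeff * g, Polynomial.C g.leadingCoeff * h, ?_, ?_, hmul, ?_, ?_,
    abs_coeff_le_of_mul hmul hf0 hD' hZ,
    abs_coeff_le_of_mul ((mul_comm _ _).trans hmul) hf0 hD' hZ⟩
  · rwa [Polynomial.natDegree_C_mul hh0]
  · rwa [Polynomial.natDegree_C_mul hg0]
  · rw [Polynomial.leadingCoeff_mul, Polynomial.leadingCoeff_C, mul_comm, hlc]
  · rw [Polynomial.leadingCoeff_mul, Polynomial.leadingCoeff_C, hlc]

theorem card_le_sum_residue_classes {n p T : ℕ} (hp : 0 < p) {S : Finset (Fin n → ℤ)}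
    (hS : ∀ N ∈ S, ∀ i, |N i| < p * T) :
    S.card ≤ ∑ N₀ ∈ Fintype.piFinset fun _ : Fin n => Finset.Ico (0 : ℤ) p,
      ((box (Fin n) T).filter fun s => (fun i => N₀ i + p * s i) ∈ S).card := by
  classical
  have hp' : (0 : ℤ) < p := by exact_mod_cast hp
  rw [Finset.card_eq_sum_card_fiberwise (f := fun N i => N i % (p : ℤ))
    (t := Fintype.piFinset fun _ : Fin n => Finset.Ico (0 : ℤ) p)]
  · refine Finset.sum_le_sum fun N₀ _ => ?_
    refine Finset.card_le_card_of_injOn (fun N i => N i / p) (fun N hN => ?_) ?_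
    · simp only [Finset.coe_filter, Set.mem_ofPred_eq] at hN ⊢
      obtain ⟨hN, rfl⟩ := hN
      refine ⟨mem_box.2 fun i => ?_, ?_⟩
      · have h1 := abs_lt.1 (hS N hN i)
        rw [abs_le]
        constructor
        · rw [Int.le_ediv_iff_mul_le hp']
          linarith [h1.1]
        · exact (Int.ediv_lt_of_lt_mul hp' (by linarith [h1.2])).le
      · convert hN using 1
        funext i
        exact Int.emod_add_mul_ediv _ _
    · intro N hN M hM hNM
      simp only [Finset.coe_filter, Set.mem_ofPred_eq] at hN hM
      funext i
      have hi : N i / (p : ℤ) = M i / p := congrFun hNM i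
      rw [← Int.emod_add_mul_ediv (N i) p, ← Int.emod_add_mul_ediv (M i) p, congrFun hN.2 i,
        congrFun hM.2 i, hi]
  · intro N _
    simp only [Finset.mem_coe, Fintype.mem_piFinset, Finset.mem_Ico]
    exact fun i => ⟨Int.emod_nonneg _ hp'.ne', Int.emod_lt_of_pos _ hp'⟩

theorem leadingCoeff_map_eval {n : ℕ} {F : Polynomial (MvPolynomial (Fin n) ℤ)} {N : Fin n → ℤ}
    (h : eval N F.leadingCoeff ≠ 0) : (F.map (eval N)).leadingCoeff = eval N F.leadingCoeff :=
  Polynomial.leadingCoeff_map_of_leadingCoeff_ne_zero _ h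

open Classical in
theorem exists_card_reducible_le {n : ℕ} {F : Polynomial (MvPolynomial (Fin n) ℤ)} (K : Type*)
    [Field K] [Algebra (MvPolynomial (Fin n) ℤ) K] [IsFractionRing (MvPolynomial (Fin n) ℤ) K]
    (hF : Irreducible (F.map (algebraMap (MvPolynomial (Fin n) ℤ) K)))
    {Δ : MvPolynomial (Fin n) ℤ} (hΔ0 : Δ ≠ 0) {U V : Polynomial (MvPolynomial (Fin n) ℤ)}
    (hΔ : U * F + V * Polynomial.derivative F = Polynomial.C Δ) :
    ∃ D d : ℕ, ∀ T : ℕ, 1 ≤ T → ∀ᶠ B : ℕ in atTop, ∃ p : ℕ, p * T ≤ 2 * B ∧ B < p * T ∧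
      ((box (Fin n) B).filter fun N => ∃ g h : Polynomial ℤ,
        1 ≤ g.natDegree ∧ 1 ≤ h.natDegree ∧ g * h = F.map (eval N)).card * ((2 * T + 1) * p) ≤
        (D * p + d * (2 * T + 1)) * (p * (2 * T + 1)) ^ n := by
  set a := F.leadingCoeff with ha_def
  have ha : a ≠ 0 := by
    rw [ha_def, Polynomial.leadingCoeff_ne_zero]
    rintro rfl
    simp at hF
  obtain ⟨c, d₀, hc⟩ := exists_abs_coeff_map_eval_le (Polynomial.C a * F)
  obtain ⟨D, hD⟩ := exists_card_class_le K hF ha hΔ (Nat.le_add_left 1 d₀)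
  obtain ⟨P₀, hP₀⟩ := exists_card_dvd_eval_mul_le (mul_ne_zero ha hΔ0)
  refine ⟨D, (a * Δ).totalDegree, fun T hT => ?_⟩
  obtain ⟨C₀, hC₀⟩ := hD (Finset.Icc (-(T : ℤ)) T)
  set D₀ := F.natDegree
  set c' := 2 ^ D₀ * ((D₀ + 1) * c)
  filter_upwards [eventually_ge_atTop (T + P₀ * T + C₀ * c' * T ^ (d₀ + 1))] with B hB
  have hBT : T ≤ B := by
    refine le_trans ?_ hB
    rw [add_assoc]
    exact Nat.le_add_right _ _
  have hBP : P₀ * T ≤ B := by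
    refine le_trans ?_ hB
    rw [add_assoc, add_left_comm]
    exact Nat.le_add_right _ _
  have hBC : C₀ * c' * T ^ (d₀ + 1) ≤ B := le_trans (Nat.le_add_left _ _) hB
  have hB1 : 1 ≤ B := hT.trans hBT
  obtain ⟨p, hp, hlt, hle⟩ := Nat.exists_prime_lt_and_le_two_mul (B / T)
    (Nat.div_pos hBT hT).ne'
  have h1 : B < p * T := by
    rw [← Nat.div_lt_iff_lt_mul hT]
    exact hlt
  have h2 : p * T ≤ 2 * B := by
    calc p * T ≤ 2 * (B / T) * T := Nat.mul_le_mul_right _ hle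
      _ = 2 * (B / T * T) := mul_assoc _ _ _
      _ ≤ 2 * B := Nat.mul_le_mul_left _ (Nat.div_mul_le_self _ _)
  refine ⟨p, h2, h1, ?_⟩
  have hp0 : P₀ < p := lt_of_mul_lt_mul_right (hBP.trans_lt h1) (Nat.zero_le T)
  set Z := 2 ^ D₀ * ((D₀ + 1) * (c * B ^ d₀)) with hZ_def
  have hZ : C₀ * Z < p ^ (d₀ + 1) := by
    have h3 : B ^ (d₀ + 1) < (p * T) ^ (d₀ + 1) := Nat.pow_lt_pow_left h1 (Nat.succ_ne_zero _)
    have h4 : C₀ * Z * T ^ (d₀ + 1) ≤ B ^ (d₀ + 1) := by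
      calc C₀ * Z * T ^ (d₀ + 1) = C₀ * c' * T ^ (d₀ + 1) * B ^ d₀ := by
            simp only [hZ_def, c']; ring
        _ ≤ B * B ^ d₀ := Nat.mul_le_mul_right _ hBC
        _ = B ^ (d₀ + 1) := by ring
    rw [mul_pow] at h3
    exact lt_of_mul_lt_mul_right (h4.trans_lt h3) (Nat.zero_le _)
  set S := (box (Fin n) B).filter fun N => ∃ g h : Polynomial ℤ,
        1 ≤ g.natDegree ∧ 1 ≤ h.natDegree ∧ g * h = F.map (eval N) with hS
  have hSsum := card_le_sum_residue_classes (n := n) (S := S) (T := T) hp.pos fun N hN i => by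
    have := mem_box.1 (Finset.mem_filter.1 hN).1 i
    have h1' : (B : ℤ) < p * T := by exact_mod_cast h1
    exact this.trans_lt h1'
  set R := Fintype.piFinset fun _ : Fin n => Finset.Ico (0 : ℤ) p
  have hpoint : ∀ N₀ ∈ R,
      ((box (Fin n) T).filter fun s => (fun i => N₀ i + p * s i) ∈ S).card * (2 * T + 1) ≤
      D * (2 * T + 1) ^ n + if (p : ℤ) ∣ eval N₀ (a * Δ) then (2 * T + 1) ^ (n + 1) else 0 := by
    intro N₀ _
    split_ifs with hbad
    · refine le_trans ?_ (Nat.le_add_left _ _)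
      rw [pow_succ]
      refine Nat.mul_le_mul_right _ ((Finset.card_filter_le _ _).trans ?_)
      rw [card_box, Fintype.card_fin]
    · rw [add_zero]
      have := hC₀ ((box (Fin n) T).filter fun s => (fun i => N₀ i + p * s i) ∈ S)
        (Finset.filter_subset _ _) p Z N₀ hp hZ hbad ?_
      · rwa [card_Icc_neg] at this
      · intro s hs
        obtain ⟨hsB, g, h, hg, hh, hgh⟩ := Finset.mem_filter.1 (Finset.mem_filter.1 hs).2
        have hα : eval (fun i => N₀ i + p * s i) a ≠ 0 := by
          intro h0
          apply hbad
          rw [map_mul]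
          refine Dvd.dvd.mul_right ?_ _
          have h5 : (eval (fun i => N₀ i + p * s i) a : ZMod p) = (eval N₀ a : ℤ) := by
            have : (Int.castRingHom (ZMod p)).comp (eval fun i => N₀ i + p * s i) =
                (Int.castRingHom (ZMod p)).comp (eval N₀) :=
              MvPolynomial.ringHom_ext (fun x => by simp) fun i => by simp
            exact RingHom.congr_fun this a
          rw [h0, Int.cast_zero] at h5
          exact (ZMod.intCast_zmod_eq_zero_iff_dvd _ p).1 h5.symm
        have hmap : (Polynomial.C a * F).map (eval fun i => N₀ i + p * s i) =
            Polynomial.C (eval (fun i => N₀ i + p * s i) a) *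
              F.map (eval fun i => N₀ i + p * s i) := by
          rw [Polynomial.map_mul, Polynomial.map_C]
        obtain ⟨g', h', h6⟩ := exists_scaled_factors hα hg hh hgh (leadingCoeff_map_eval hα)
          (D := D₀) (Z := c * B ^ d₀) Polynomial.natDegree_map_le fun j => by
            rw [← hmap]
            exact hc B hB1 _ (mem_box.1 hsB) j
        refine ⟨g', h', ?_⟩
        rw [hmap]
        exact h6
  have hR : R.card = p ^ n := by
    simp [R]
  have hbadcard := hP₀ p hp hp0
  have hsum := Finset.sum_le_sum hpoint
  rw [← Finset.sum_mul, Finset.sum_add_distrib, Finset.sum_const, hR, smul_eq_mul,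
    ← Finset.sum_filter, Finset.sum_const, smul_eq_mul] at hsum
  calc S.card * ((2 * T + 1) * p)
      ≤ (∑ N₀ ∈ R, ((box (Fin n) T).filter fun s => (fun i => N₀ i + p * s i) ∈ S).card) *
          ((2 * T + 1) * p) := Nat.mul_le_mul_right _ hSsum
    _ = (∑ N₀ ∈ R, ((box (Fin n) T).filter fun s => (fun i => N₀ i + p * s i) ∈ S).card) *
          (2 * T + 1) * p := (mul_assoc _ _ _).symm
    _ ≤ (p ^ n * (D * (2 * T + 1) ^ n) +
          (R.filter fun N₀ => (p : ℤ) ∣ eval N₀ (a * Δ)).card * (2 * T + 1) ^ (n + 1)) * p :=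
        Nat.mul_le_mul_right _ hsum
    _ = p ^ n * (D * (2 * T + 1) ^ n) * p +
          (R.filter fun N₀ => (p : ℤ) ∣ eval N₀ (a * Δ)).card * p * (2 * T + 1) ^ (n + 1) := by
        ring
    _ ≤ p ^ n * (D * (2 * T + 1) ^ n) * p +
          (a * Δ).totalDegree * p ^ n * (2 * T + 1) ^ (n + 1) :=
        Nat.add_le_add_left (Nat.mul_le_mul_right _ hbadcard) _
    _ = _ := by rw [mul_pow]; ring

theorem exists_bezout_of_isCoprime_map {A K : Type*} [CommRing A] [IsDomain A] [Field K]
    [Algebra A K] [IsFractionRing A K] {f g : Polynomial A}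
    (h : IsCoprime (f.map (algebraMap A K)) (g.map (algebraMap A K))) :
    ∃ u v : Polynomial A, ∃ d : A, d ≠ 0 ∧ u * f + v * g = Polynomial.C d := by
  obtain ⟨u, v, huv⟩ := h
  obtain ⟨b, hb, hu⟩ := IsLocalization.integerNormalization_spec (nonZeroDivisors A) u
  obtain ⟨c, hc, hv⟩ := IsLocalization.integerNormalization_spec (nonZeroDivisors A) v
  refine ⟨Polynomial.C c * IsLocalization.integerNormalization (nonZeroDivisors A) u,
    Polynomial.C b * IsLocalization.integerNormalization (nonZeroDivisors A) v, c * b,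
    mul_ne_zero (nonZeroDivisors.ne_zero hc) (nonZeroDivisors.ne_zero hb), ?_⟩
  rw [algebra_compatible_smul K, Polynomial.smul_eq_C_mul] at hu hv
  refine Polynomial.map_injective _ (IsFractionRing.injective A K) ?_
  simp only [Polynomial.map_add, Polynomial.map_mul, Polynomial.map_C, hu, hv, map_mul]
  linear_combination (Polynomial.C (algebraMap A K c) * Polynomial.C (algebraMap A K b)) * huv

open Classical in
/-- The quantitative form of Hilbert's irreducibility theorem for one polynomial in one variable:
the specializations that factor have density zero. -/
theorem eventually_card_reducible_le {n : ℕ} {F : Polynomial (MvPolynomial (Fin n) ℤ)}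
    (hF : Irreducible F) (hdeg : F.natDegree ≠ 0) {ε : ℝ} (hε : 0 < ε) :
    ∀ᶠ B : ℕ in atTop, (((box (Fin n) B).filter fun N => ∃ g h : Polynomial ℤ,
        1 ≤ g.natDegree ∧ 1 ≤ h.natDegree ∧ g * h = F.map (eval N)).card : ℝ) ≤
      ε * (2 * B + 1) ^ n := by
  set K := FractionRing (MvPolynomial (Fin n) ℤ)
  have hFK : Irreducible (F.map (algebraMap (MvPolynomial (Fin n) ℤ) K)) :=
    ((hF.isPrimitive hdeg).irreducible_iff_irreducible_map_fraction_map).1 hF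
  have hinj := IsFractionRing.injective (MvPolynomial (Fin n) ℤ) K
  have : CharZero K := by
    refine charZero_of_injective_ringHom (f := (algebraMap (MvPolynomial (Fin n) ℤ) K).comp C) ?_
    exact hinj.comp (C_injective _ _)
  have hsep := hFK.separable
  rw [Polynomial.separable_def, Polynomial.derivative_map] at hsep
  obtain ⟨U, V, Δ, hΔ0, hΔ⟩ := exists_bezout_of_isCoprime_map hsep
  obtain ⟨D, d, hDd⟩ := exists_card_reducible_le K hFK hΔ0 hΔ
  obtain ⟨T, hT⟩ := exists_nat_ge (3 ^ n * D / ε + 1)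
  have hT1 : (1 : ℝ) ≤ T := le_trans (le_add_of_nonneg_left (by positivity)) hT
  have hT0 : (0 : ℝ) < T := by linarith
  obtain ⟨B₀, hB₀⟩ := exists_nat_ge (2 * 3 ^ n * d * T / ε)
  filter_upwards [hDd T (by exact_mod_cast hT1), eventually_ge_atTop B₀] with B hB hBB
  obtain ⟨p, hp1, hp2, hcard⟩ := hB
  set R := ((box (Fin n) B).filter fun N => ∃ g h : Polynomial ℤ,
        1 ≤ g.natDegree ∧ 1 ≤ h.natDegree ∧ g * h = F.map (eval N)).card
  have hB0' : (2 * 3 ^ n * d * T / ε : ℝ) ≤ B := hB₀.trans (by exact_mod_cast hBB)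
  have hp1' : (p : ℝ) * T ≤ 2 * B := by exact_mod_cast hp1
  have hp2' : (B : ℝ) < p * T := by exact_mod_cast hp2
  have hp0 : (0 : ℝ) < p := by
    by_contra! h0
    have : (0 : ℝ) ≤ B := Nat.cast_nonneg _
    nlinarith
  have hcard' : (R : ℝ) * ((2 * T + 1) * p) ≤
      (D * p + d * (2 * T + 1)) * (p * (2 * T + 1)) ^ n := by exact_mod_cast hcard
  have hbase : (p : ℝ) * (2 * T + 1) ≤ 3 * (2 * B + 1) := by nlinarith
  have hpow : ((p : ℝ) * (2 * T + 1)) ^ n ≤ 3 ^ n * (2 * B + 1) ^ n := by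
    rw [← mul_pow]
    exact pow_le_pow_left₀ (by positivity) hbase n
  have hD' : 3 ^ n * (D : ℝ) ≤ ε / 2 * (2 * T + 1) := by
    have : 3 ^ n * D / ε ≤ T := by linarith
    rw [div_le_iff₀ hε] at this
    nlinarith
  have hd' : 3 ^ n * (d : ℝ) ≤ ε / 2 * p := by
    rw [div_le_iff₀ hε] at hB0'
    have : 3 ^ n * (d : ℝ) * T ≤ ε / 2 * p * T := by nlinarith
    exact le_of_mul_le_mul_right this hT0
  have hfin : (R : ℝ) * ((2 * T + 1) * p) ≤ ε * (2 * B + 1) ^ n * ((2 * T + 1) * p) := by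
    calc (R : ℝ) * ((2 * T + 1) * p)
        ≤ (D * p + d * (2 * T + 1)) * (3 ^ n * (2 * B + 1) ^ n) :=
          hcard'.trans (mul_le_mul_of_nonneg_left hpow (by positivity))
      _ = (3 ^ n * D * p + 3 ^ n * d * (2 * T + 1)) * (2 * B + 1) ^ n := by ring
      _ ≤ (ε / 2 * (2 * T + 1) * p + ε / 2 * p * (2 * T + 1)) * (2 * B + 1) ^ n := by gcongr
      _ = _ := by ring
  exact le_of_mul_le_mul_right hfin (by positivity)

theorem coeff_prod_of_natDegree_le {ι R : Type*} [CommSemiring R] (s : Finset ι)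
    (f : ι → Polynomial R) (e : ι → ℕ) (h : ∀ i ∈ s, (f i).natDegree ≤ e i) :
    (∏ i ∈ s, f i).natDegree ≤ ∑ i ∈ s, e i ∧
      (∏ i ∈ s, f i).coeff (∑ i ∈ s, e i) = ∏ i ∈ s, (f i).coeff (e i) := by
  classical
  induction s using Finset.induction_on with
  | empty => simp
  | insert i s hi ih =>
    obtain ⟨h1, h2⟩ := ih fun j hj => h j (Finset.mem_insert_of_mem hj)
    have h3 := h i (Finset.mem_insert_self i s)
    rw [Finset.prod_insert hi, Finset.sum_insert hi, Finset.prod_insert hi,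
      Polynomial.coeff_mul_add_eq_of_natDegree_le h3 h1, h2]
    exact ⟨Polynomial.natDegree_mul_le.trans (Nat.add_le_add h3 h1), rfl⟩

/-- Restriction of a polynomial to the line through `b` with direction `c`. -/
noncomputable def line {τ R : Type*} [CommSemiring R] (b c : τ → R) :
    MvPolynomial τ R →+* Polynomial R :=
  eval₂Hom Polynomial.C fun i => Polynomial.C (b i) + Polynomial.C (c i) * Polynomial.X

theorem line_X {τ R : Type*} [CommSemiring R] (b c : τ → R) (i : τ) :
    line b c (X i) = Polynomial.C (b i) + Polynomial.C (c i) * Polynomial.X := by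
  rw [line, eval₂Hom_X']

theorem line_C {τ R : Type*} [CommSemiring R] (b c : τ → R) (x : R) :
    line b c (C x) = Polynomial.C x := by
  rw [line, eval₂Hom_C]

theorem natDegree_line_monomial {τ R : Type*} [CommSemiring R] (b c : τ → R) (μ : τ →₀ ℕ) (x : R) :
    (line b c (monomial μ x)).natDegree ≤ μ.degree ∧
      (line b c (monomial μ x)).coeff μ.degree = eval c (monomial μ x) := by
  have h1 : ∀ i, (Polynomial.C (b i) + Polynomial.C (c i) * Polynomial.X).natDegree ≤ 1 := fun i =>
    Polynomial.natDegree_add_le_of_degree_le (by simp)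
      ((Polynomial.natDegree_C_mul_le _ _).trans Polynomial.natDegree_X_le)
  have h2 : ∀ i ∈ μ.support,
      ((Polynomial.C (b i) + Polynomial.C (c i) * Polynomial.X) ^ μ i).natDegree ≤ μ i := fun i _ =>
    by simpa using Polynomial.natDegree_pow_le_of_le (μ i) (h1 i)
  obtain ⟨h3, h4⟩ := coeff_prod_of_natDegree_le _ _ _ h2
  rw [line, coe_eval₂Hom, eval₂_monomial, eval_monomial, Polynomial.coeff_C_mul,
    Finsupp.degree_apply,
    Finsupp.prod]
  refine ⟨(Polynomial.natDegree_C_mul_le _ _).trans h3, ?_⟩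
  rw [h4, Finsupp.prod]
  congr 1
  refine Finset.prod_congr rfl fun i _ => ?_
  have := Polynomial.coeff_pow_of_natDegree_le (m := μ i) (h1 i)
  rw [mul_one] at this
  rw [this]
  simp

theorem natDegree_line_le {τ R : Type*} [CommSemiring R] (b c : τ → R) (p : MvPolynomial τ R) :
    (line b c p).natDegree ≤ p.totalDegree := by
  conv_lhs => rw [p.as_sum, map_sum]
  refine Polynomial.natDegree_sum_le_of_forall_le _ _ fun μ hμ => ?_
  exact (natDegree_line_monomial b c μ _).1.trans (le_totalDegree hμ)

theorem coeff_line {τ R : Type*} [CommSemiring R] (b c : τ → R) {p : MvPolynomial τ R} {d : ℕ}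
    (hd : p.totalDegree ≤ d) :
    (line b c p).coeff d = eval c (homogeneousComponent d p) := by
  rw [homogeneousComponent_apply, map_sum]
  conv_lhs => rw [p.as_sum, map_sum, Polynomial.finsetSum_coeff]
  rw [Finset.sum_filter]
  refine Finset.sum_congr rfl fun μ hμ => ?_
  split_ifs with h
  · rw [← h]
    exact (natDegree_line_monomial b c μ _).2
  · refine Polynomial.coeff_eq_zero_of_natDegree_lt
      ((natDegree_line_monomial b c μ _).1.trans_lt (lt_of_le_of_ne ?_ h))
    exact (le_totalDegree hμ).trans hd

theorem homogeneousComponent_totalDegree_ne_zero {τ R : Type*} [CommSemiring R]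
    {p : MvPolynomial τ R} (hp : p ≠ 0) : homogeneousComponent p.totalDegree p ≠ 0 := by
  obtain ⟨μ, hμ, h⟩ := Finset.exists_mem_eq_sup p.support (support_nonempty.2 hp)
    fun s : τ →₀ ℕ => s.sum fun _ e => e
  intro h0
  have h1 : (homogeneousComponent p.totalDegree p).coeff μ = 0 := by rw [h0, coeff_zero]
  rw [coeff_homogeneousComponent, if_pos] at h1
  · exact mem_support_iff.1 hμ h1
  · exact h.symm

/-- Translation by the generic multiple of a vector is irreducibility preserving. -/
theorem irreducible_line_C {σ R : Type*} [CommRing R] [IsDomain R] [UniqueFactorizationMonoid R]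
    {P : MvPolynomial σ R} (hP : Irreducible P) (v : σ → R) :
    Irreducible (eval₂Hom (Polynomial.C.comp C) (fun i => Polynomial.C (X i) +
      Polynomial.C (C (v i)) * Polynomial.X) P : Polynomial (MvPolynomial σ R)) := by
  set φ : (σ → R) → MvPolynomial σ R →+* Polynomial (MvPolynomial σ R) := fun v =>
    eval₂Hom (Polynomial.C.comp C) (fun i => Polynomial.C (X i) +
      Polynomial.C (C (v i)) * Polynomial.X) with hφ
  have hφX : ∀ v i, φ v (X i) = Polynomial.C (X i) + Polynomial.C (C (v i)) * Polynomial.X :=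
    fun v i => eval₂Hom_X' _ _ _
  have hφC : ∀ v x, φ v (C x) = Polynomial.C (C x) := fun v x => eval₂Hom_C _ _ _
  set α : (σ → R) → Polynomial (MvPolynomial σ R) →+* Polynomial (MvPolynomial σ R) := fun v =>
    Polynomial.eval₂RingHom (φ v) Polynomial.X with hα
  have hαC : ∀ v Q, α v (Polynomial.C Q) = φ v Q := fun v Q => Polynomial.eval₂_C _ _
  have hαX : ∀ v, α v Polynomial.X = Polynomial.X := fun v => Polynomial.eval₂_X _ _
  have hinv : ∀ v w : σ → R, v + w = 0 → (α v).comp (α w) = RingHom.id _ := by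
    intro v w hvw
    refine Polynomial.ringHom_ext' ?_ ?_
    · refine MvPolynomial.ringHom_ext (fun x => ?_) fun i => ?_
      · simp only [RingHom.comp_apply, hαC, hφC, RingHom.id_apply]
      · have : C (v i) + C (w i) = (0 : MvPolynomial σ R) := by
          rw [← C_add, ← Pi.add_apply, hvw, Pi.zero_apply, C_0]
        simp only [RingHom.comp_apply, hαC, hφX, map_add, map_mul, hφC, RingHom.id_apply, hαX]
        rw [add_assoc, ← add_mul, ← Polynomial.C_add, this, Polynomial.C_0, zero_mul, add_zero]
    · simp only [RingHom.comp_apply, hαX, RingHom.id_apply]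
  have hαP : φ v P = RingEquiv.ofRingHom (α v) (α (-v)) (hinv _ _ (add_neg_cancel v))
      (hinv _ _ (neg_add_cancel v)) (Polynomial.C P) := (hαC v P).symm
  rw [hαP, MulEquiv.irreducible_iff]
  exact (Polynomial.prime_C_iff.2 hP.prime).irreducible

/-- The identification `ℤ[x, y] ≃ ℤ[x][y]`. -/
noncomputable def toY (r m : ℕ) : MvPolynomial (Fin r ⊕ Fin m) ℤ ≃ₐ[ℤ]
    MvPolynomial (Fin m) (MvPolynomial (Fin r) ℤ) :=
  (renameEquiv ℤ (Equiv.sumComm (Fin r) (Fin m))).trans (sumAlgEquiv ℤ (Fin m) (Fin r))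

theorem toY_X_inl {r m : ℕ} (i : Fin r) : toY r m (X (Sum.inl i)) = C (X i) := by
  simp [toY, sumAlgEquiv_X_inr]

theorem toY_X_inr {r m : ℕ} (i : Fin m) : toY r m (X (Sum.inr i)) = X i := by
  simp [toY, sumAlgEquiv_X_inl]

theorem specX_eq_map {r m : ℕ} (n : Fin r → ℤ) (P : MvPolynomial (Fin r ⊕ Fin m) ℤ) :
    specX r m n P = MvPolynomial.map (eval n) (toY r m P) := by
  suffices specX r m n = (MvPolynomial.map (eval n)).comp (toY r m : _ →+* _) from
    congrArg (fun f : _ →+* _ => f P) this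
  refine MvPolynomial.ringHom_ext (fun x => ?_) fun i => ?_
  · simp [specX]
  · rcases i with i | i
    · simp [specX, toY_X_inl]
    · simp [specX, toY_X_inr]

theorem toY_rename_inl {r m : ℕ} (q : MvPolynomial (Fin r) ℤ) :
    toY r m (rename Sum.inl q) = C q := by
  suffices (toY r m).toAlgHom.toRingHom.comp (rename Sum.inl).toRingHom = C from
    congrArg (fun f : _ →+* _ => f q) this
  refine MvPolynomial.ringHom_ext (fun x => ?_) fun i => ?_
  · simp
  · simp [toY_X_inl]

theorem one_le_totalDegree_toY {r m : ℕ} {P : MvPolynomial (Fin r ⊕ Fin m) ℤ}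
    (h : ∃ d ∈ P.support, ∃ i : Fin m, d (Sum.inr i) ≠ 0) : 1 ≤ (toY r m P).totalDegree := by
  by_contra! h0
  have h1 := totalDegree_eq_zero_iff_eq_C.1 (Nat.lt_one_iff.1 h0)
  rw [← toY_rename_inl] at h1
  obtain ⟨d, hd, i, hi⟩ := h
  rw [(toY r m).injective h1, mem_support_iff] at hd
  obtain ⟨u, rfl, -⟩ := coeff_rename_ne_zero _ _ _ hd
  exact hi (Finsupp.mapDomain_of_notMem_range _ _ (by simp))

theorem totalDegree_specX_le {r m : ℕ} (n : Fin r → ℤ) (P : MvPolynomial (Fin r ⊕ Fin m) ℤ) :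
    (specX r m n P).totalDegree ≤ (toY r m P).totalDegree := by
  rw [specX_eq_map]
  exact Finset.sup_mono (support_map_subset _ _)

theorem line_map {τ R S : Type*} [CommSemiring R] [CommSemiring S] (f : R →+* S) (b c : τ → R)
    (p : MvPolynomial τ R) : line (f ∘ b) (f ∘ c) (MvPolynomial.map f p) = (line b c p).map f := by
  suffices (line (f ∘ b) (f ∘ c)).comp (MvPolynomial.map f) =
      (Polynomial.mapRingHom f).comp (line b c) from
    congrArg (fun f : _ →+* _ => f p) this
  refine MvPolynomial.ringHom_ext (fun x => ?_) fun i => ?_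
  · simp [line_C]
  · simp [line_X]

theorem coeff_line_specX {r m : ℕ} (n : Fin r → ℤ) (P : MvPolynomial (Fin r ⊕ Fin m) ℤ)
    (b c : Fin m → ℤ) :
    (line b c (specX r m n P)).coeff (toY r m P).totalDegree =
      eval n (eval (fun i => C (c i))
        (homogeneousComponent (toY r m P).totalDegree (toY r m P))) := by
  have := line_map (eval n) (fun i => C (b i)) (fun i => C (c i)) (toY r m P)
  rw [← coeff_line (fun i => C (b i)) _ le_rfl, specX_eq_map, ← Polynomial.coeff_map, ← this]
  simp [Function.comp_def]

theorem exists_eval_C_ne_zero {r m : ℕ} {p : MvPolynomial (Fin m) (MvPolynomial (Fin r) ℤ)}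
    (hp : p ≠ 0) : ∃ c : Fin m → ℤ, eval (fun i => C (c i)) p ≠ 0 := by
  by_contra! h
  refine hp (funext_set (fun _ => Set.range (C : ℤ → MvPolynomial (Fin r) ℤ))
    (fun _ => Set.infinite_range_of_injective (C_injective _ _)) fun x hx => ?_)
  choose c hc using fun i => hx i (Set.mem_univ i)
  rw [map_zero, ← h c]
  exact congrArg (fun x => eval x p) (funext fun i => (hc i).symm)

/-- A polynomial over `ℤ` with no prime divisor factors, if at all, in positive degrees. -/
theorem exists_mul_eq_of_not_irreducible {τ : Type*} {f : MvPolynomial τ ℤ}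
    (hf : ∀ p : ℕ, p.Prime → ¬ C (p : ℤ) ∣ f) (hirr : ¬ Irreducible f) (hd : f.totalDegree ≠ 0) :
    ∃ g h : MvPolynomial τ ℤ, f = g * h ∧ 1 ≤ g.totalDegree ∧ 1 ≤ h.totalDegree := by
  have hu : ¬ IsUnit f := by
    intro hu
    obtain ⟨x, -, hx⟩ := isUnit_iff_eq_C_of_isReduced.1 hu
    exact hd (by rw [hx, totalDegree_C])
  have key : ∀ g h : MvPolynomial τ ℤ, f = g * h → ¬ IsUnit g → 1 ≤ g.totalDegree := by
    intro g h hgh hg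
    by_contra! h0
    have h1 := totalDegree_eq_zero_iff_eq_C.1 (Nat.lt_one_iff.1 h0)
    have h2 : (g.coeff 0).natAbs ≠ 1 := fun h2 => hg (by
      rw [h1]; exact (Int.isUnit_iff_natAbs_eq.2 h2).map C)
    obtain ⟨p, hp, hpd⟩ := Nat.exists_prime_and_dvd h2
    refine hf p hp ?_
    rw [hgh, h1]
    exact ((map_dvd C (Int.natCast_dvd.2 hpd))).mul_right _
  rw [irreducible_iff] at hirr
  push Not at hirr
  obtain ⟨g, h, hgh, hg, hh⟩ := hirr hu
  exact ⟨g, h, hgh, key g h hgh hg, key h g (hgh.trans (mul_comm _ _)) hh⟩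

open Classical in
theorem eventually_card_not_irreducible_le {r m : ℕ} {P : MvPolynomial (Fin r ⊕ Fin m) ℤ}
    (hP : Irreducible P) (hdeg : ∃ d ∈ P.support, ∃ i : Fin m, d (Sum.inr i) ≠ 0)
    {ε : ℝ} (hε : 0 < ε) :
    ∀ᶠ B : ℕ in atTop, (((box (Fin r) B).filter fun n =>
      (∀ p : ℕ, p.Prime → ¬ C (p : ℤ) ∣ specX r m n P) ∧
        ¬ Irreducible (specX r m n P)).card : ℝ) ≤ ε * (2 * B + 1) ^ r := by
  set d := (toY r m P).totalDegree with hd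
  have hd1 : 1 ≤ d := one_le_totalDegree_toY hdeg
  have hY0 : toY r m P ≠ 0 := by
    rw [Ne, EmbeddingLike.map_eq_zero_iff]
    exact hP.ne_zero
  obtain ⟨c, hc⟩ := exists_eval_C_ne_zero (homogeneousComponent_totalDegree_ne_zero hY0)
  set W := eval (fun i => C (c i)) (homogeneousComponent d (toY r m P)) with hW
  set F := eval₂Hom (Polynomial.C.comp C) (fun i => Polynomial.C (X i) +
      Polynomial.C (C (Sum.elim (0 : Fin r → ℤ) c i)) * Polynomial.X) P with hF
  have hFirr : Irreducible F := irreducible_line_C hP _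
  have hFmap : ∀ n b, F.map (eval (Sum.elim n b)) = line b c (specX r m n P) := by
    intro n b
    suffices (Polynomial.mapRingHom (eval (Sum.elim n b))).comp
        (eval₂Hom (Polynomial.C.comp C) (fun i => Polynomial.C (X i) +
          Polynomial.C (C (Sum.elim (0 : Fin r → ℤ) c i)) * Polynomial.X)) =
        (line b c).comp (specX r m n) from congrArg (fun f : _ →+* _ => f P) this
    refine MvPolynomial.ringHom_ext (fun x => ?_) fun i => ?_
    · simp [specX]
    · rcases i with i | i
      · simp [specX]
      · simp [specX, line_X]
  set e : Polynomial (MvPolynomial (Fin r ⊕ Fin m) ℤ) ≃+*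
      Polynomial (MvPolynomial (Fin (r + m)) ℤ) :=
    Polynomial.mapEquiv (renameEquiv ℤ finSumFinEquiv).toRingEquiv with he
  have heF : e F = F.map (rename finSumFinEquiv : _ →ₐ[ℤ] _).toRingHom := rfl
  have hemap : ∀ n b, (e F).map (eval (Sum.elim n b ∘ finSumFinEquiv.symm)) =
      line b c (specX r m n P) := by
    intro n b
    rw [heF, Polynomial.map_map, ← hFmap]
    congr 1
    refine MvPolynomial.ringHom_ext (fun x => ?_) fun i => ?_ <;> simp
  have hcoeff : ∀ n b, (line b c (specX r m n P)).coeff d = eval n W := fun n b =>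
    coeff_line_specX n P b c
  have hW0 : ∃ n, eval n W ≠ 0 := by
    by_contra! h
    exact hc (MvPolynomial.funext fun n => by rw [h n, map_zero])
  have hdegF : (e F).natDegree ≠ 0 := by
    obtain ⟨n, hn⟩ := hW0
    have h1 := Polynomial.le_natDegree_of_ne_zero ((hcoeff n 0).trans_ne hn)
    rw [← hemap] at h1
    have := h1.trans Polynomial.natDegree_map_le
    omega
  have hred := eventually_card_reducible_le (MulEquiv.irreducible_iff e |>.2 hFirr) hdegF
    (half_pos hε)
  have hlarge : ∀ᶠ B : ℕ in atTop, (W.totalDegree : ℝ) / (ε / 2) ≤ B :=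
    tendsto_natCast_atTop_atTop.eventually_ge_atTop _
  filter_upwards [hred, hlarge] with B hB1 hB2
  set S := (box (Fin r) B).filter fun n =>
      (∀ p : ℕ, p.Prime → ¬ C (p : ℤ) ∣ specX r m n P) ∧ ¬ Irreducible (specX r m n P) with hS
  set Z := (box (Fin r) B).filter fun n => eval n W = 0 with hZ
  have hpos : (0 : ℝ) < 2 * B + 1 := by positivity
  have hZc : (Z.card : ℝ) ≤ ε / 2 * (2 * B + 1) ^ r := by
    have h1 := card_zeros_mul_le hc (Finset.Icc (-(B : ℤ)) B)
    rw [card_Icc_neg] at h1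
    have h2 : (Z.card : ℝ) * (2 * B + 1) ≤ W.totalDegree * (2 * B + 1) ^ r := by
      exact_mod_cast h1
    have h3 : (W.totalDegree : ℝ) ≤ ε / 2 * (2 * B + 1) := by
      rw [div_le_iff₀ (half_pos hε)] at hB2
      nlinarith [(Nat.cast_nonneg B : (0 : ℝ) ≤ B)]
    have h4 : (Z.card : ℝ) * (2 * B + 1) ≤ (ε / 2 * (2 * B + 1) ^ r) * (2 * B + 1) := by
      refine h2.trans ((mul_le_mul_of_nonneg_right h3 (by positivity)).trans (le_of_eq (by ring)))
    exact le_of_mul_le_mul_right h4 hpos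
  have hSZ : ((S \ Z).card : ℝ) ≤ ε / 2 * (2 * B + 1) ^ r := by
    have h1 : ((S \ Z) ×ˢ box (Fin m) B).card ≤ ((box (Fin (r + m)) B).filter fun N =>
        ∃ g h : Polynomial ℤ, 1 ≤ g.natDegree ∧ 1 ≤ h.natDegree ∧
          g * h = (e F).map (eval N)).card := by
      refine Finset.card_le_card_of_injOn
        (fun nb => Sum.elim nb.1 nb.2 ∘ finSumFinEquiv.symm) ?_ ?_
      · rintro ⟨n, b⟩ hnb
        simp only [Finset.coe_product, Set.mem_prod, Finset.mem_coe, Finset.mem_sdiff] at hnb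
        obtain ⟨⟨hn, hnZ⟩, hb⟩ := hnb
        rw [hS, Finset.mem_filter] at hn
        obtain ⟨hnB, hn1, hn2⟩ := hn
        have hWn : eval n W ≠ 0 := fun h => hnZ (Finset.mem_filter.2 ⟨hnB, h⟩)
        rw [Finset.mem_coe, Finset.mem_filter]
        refine ⟨?_, ?_⟩
        · rw [mem_box] at hnB hb ⊢
          intro i
          change |Sum.elim n b (finSumFinEquiv.symm i)| ≤ (B : ℤ)
          rcases finSumFinEquiv.symm i with j | j
          · exact hnB j
          · exact hb j
        · have hdn := Polynomial.le_natDegree_of_ne_zero ((hcoeff n b).trans_ne hWn)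
          have hle : (specX r m n P).totalDegree ≤ d := totalDegree_specX_le n P
          have hle2 := natDegree_line_le b c (specX r m n P)
          obtain ⟨g, h, hgh, hg, hh⟩ := exists_mul_eq_of_not_irreducible hn1 hn2 (by omega)
          have hg0 : g ≠ 0 := by rintro rfl; simp at hg
          have hh0 : h ≠ 0 := by rintro rfl; simp at hh
          have h5 := natDegree_line_le b c g
          have h6 := natDegree_line_le b c h
          rw [hgh, totalDegree_mul_of_isDomain hg0 hh0] at hle
          rw [hgh, map_mul] at hdn
          have h7 := hdn.trans Polynomial.natDegree_mul_le
          refine ⟨line b c g, line b c h, by omega, by omega, ?_⟩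
          rw [hemap, hgh, map_mul]
      · rintro ⟨n, b⟩ - ⟨n', b'⟩ - h
        have h1 := finSumFinEquiv.symm.surjective.injective_comp_right h
        have h2 : n = n' := funext fun i => congrFun h1 (Sum.inl i)
        have h3 : b = b' := funext fun i => congrFun h1 (Sum.inr i)
        rw [h2, h3]
    rw [Finset.card_product, card_box, Fintype.card_fin] at h1
    have h2 : ((S \ Z).card : ℝ) * (2 * B + 1) ^ m ≤
        (ε / 2 * (2 * B + 1) ^ r) * (2 * B + 1) ^ m := by
      rw [mul_assoc, ← pow_add]
      exact le_trans (by exact_mod_cast h1) hB1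
    exact le_of_mul_le_mul_right h2 (by positivity)
  have : S.card ≤ (S \ Z).card + Z.card := by
    have := Finset.le_card_sdiff Z S
    omega
  have : (S.card : ℝ) ≤ (S \ Z).card + Z.card := by exact_mod_cast this
  linarith

/-- Polynomials in one variable over a factorial ring without a common factor generate an ideal
containing a nonzero constant. -/
theorem exists_C_mem_span {A : Type*} [CommRing A] [IsDomain A] [UniqueFactorizationMonoid A]
    {s : Set (Polynomial A)} (hs : ∀ u, (∀ f ∈ s, u ∣ f) → IsUnit u) :
    ∃ R : A, R ≠ 0 ∧ Polynomial.C R ∈ Ideal.span s := by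
  by_contra! hno
  obtain ⟨𝔭, hp, hle, hdisj⟩ := Ideal.exists_le_prime_disjoint (Ideal.span s)
    ((nonZeroDivisors A).map (Polynomial.C : A →+* Polynomial A)) (by
      rw [Set.disjoint_left]
      rintro _ hx ⟨a, ha, rfl⟩
      exact hno a (nonZeroDivisors.ne_zero ha) hx)
  have hconst : ∀ a : A, Polynomial.C a ∈ 𝔭 → a = 0 := fun a ha => by
    by_contra h0
    exact Set.disjoint_left.1 hdisj ha ⟨a, mem_nonZeroDivisors_of_ne_zero h0, rfl⟩
  by_cases hbot : 𝔭 = ⊥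
  · refine Polynomial.not_isUnit_X (hs Polynomial.X fun f hf => ?_)
    have := hle (Ideal.subset_span hf)
    rw [hbot, Ideal.mem_bot] at this
    rw [this]
    exact dvd_zero _
  · obtain ⟨π, hπ, hprime⟩ := hp.exists_mem_prime_of_ne_bot hbot
    have hdeg : π.natDegree ≠ 0 := by
      intro h
      rw [Polynomial.eq_C_of_natDegree_eq_zero h] at hπ
      apply hprime.ne_zero
      rw [Polynomial.eq_C_of_natDegree_eq_zero h, hconst _ hπ, Polynomial.C_0]
    have hprim := hprime.irreducible.isPrimitive hdeg
    refine hprime.not_isUnit (hs π fun f hf => ?_)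
    refine hprim.dvd_of_fraction_map_dvd_fraction_map (K := FractionRing A) ?_
    by_contra hnd
    obtain ⟨u, v, d, hd, huv⟩ := exists_bezout_of_isCoprime_map
      ((hprim.irreducible_iff_irreducible_map_fraction_map.1
        hprime.irreducible).coprime_iff_not_dvd.2 hnd)
    refine hd (hconst d ?_)
    rw [← huv]
    exact 𝔭.add_mem (𝔭.mul_mem_left _ hπ) (𝔭.mul_mem_left _ (hle (Ideal.subset_span hf)))

theorem isUnit_of_forall_dvd_coeff {A : Type*} [CommRing A] [IsDomain A]
    {s : Set (Polynomial A)} (hs : ∀ u, (∀ f ∈ s, u ∣ f) → IsUnit u) {u : A}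
    (hu : ∀ f ∈ s, ∀ i, u ∣ f.coeff i) : IsUnit u :=
  Polynomial.isUnit_C.1 (hs _ fun f hf => Polynomial.C_dvd_iff_dvd_coeff _ _ |>.2 (hu f hf))

open Classical in
/-- Few integers in an interval are zeros modulo `p` of a polynomial not divisible by `p`. -/
theorem card_filter_dvd_eval_le {p : ℕ} (hp : p.Prime) {f : Polynomial ℤ}
    (hf : ¬ Polynomial.C (p : ℤ) ∣ f) {A : Finset ℤ} {a : ℤ} {L : ℕ}
    (hA : ∀ x ∈ A, a ≤ x ∧ x < a + p * L) :
    (A.filter fun x => (p : ℤ) ∣ f.eval x).card ≤ f.natDegree * L := by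
  have := Fact.mk hp
  rw [C_dvd_iff_map_eq_zero] at hf
  set g := f.map (Int.castRingHom (ZMod p)) with hg
  have hp0 : (0 : ℤ) < p := by exact_mod_cast hp.pos
  calc (A.filter fun x => (p : ℤ) ∣ f.eval x).card
      ≤ (g.roots.toFinset ×ˢ Finset.range L).card := by
        refine Finset.card_le_card_of_injOn
          (fun x => ((x : ZMod p), ((x - a) / p).toNat)) ?_ ?_
        · intro x hx
          rw [Finset.mem_coe, Finset.mem_filter] at hx
          obtain ⟨h1, h2⟩ := hA x hx.1
          have h3 : (x - a) / p < L := Int.ediv_lt_of_lt_mul hp0 (by linarith)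
          have h4 : 0 ≤ (x - a) / p := Int.ediv_nonneg (by linarith) hp0.le
          rw [Finset.mem_coe, Finset.mem_product, Multiset.mem_toFinset, Polynomial.mem_roots hf,
            Finset.mem_range]
          refine ⟨?_, by dsimp only; omega⟩
          have h5 := Polynomial.eval_map_apply (p := f) (Int.castRingHom (ZMod p)) x
          rw [Polynomial.IsRoot, hg]
          simpa using h5.trans ((ZMod.intCast_zmod_eq_zero_iff_dvd _ _).2 hx.2)
        · intro x hx y hy hxy
          rw [Finset.mem_coe, Finset.mem_filter] at hx hy
          rw [Prod.mk.injEq] at hxy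
          have hx4 : 0 ≤ (x - a) / p := Int.ediv_nonneg (by linarith [(hA x hx.1).1]) hp0.le
          have hy4 : 0 ≤ (y - a) / p := Int.ediv_nonneg (by linarith [(hA y hy.1).1]) hp0.le
          have h6 : (x - a) / p = (y - a) / p := by
            have := hxy.2
            omega
          have h7 := ((ZMod.intCast_eq_intCast_iff _ _ _).1 hxy.1).sub_right a
          have h8 := Int.emod_add_mul_ediv (x - a) p
          have h9 := Int.emod_add_mul_ediv (y - a) p
          rw [h6, h7] at h8
          linarith
    _ ≤ f.natDegree * L := by
        rw [Finset.card_product, Finset.card_range]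
        exact Nat.mul_le_mul_right _ ((Multiset.toFinset_card_le _).trans
          ((Polynomial.card_roots' _).trans Polynomial.natDegree_map_le))

theorem card_filter_piFinset_succ_le {α : Type*} [DecidableEq α] {n K : ℕ} (A : Finset α)
    (p : (Fin (n + 1) → α) → Prop) [DecidablePred p] (X Y : Finset (Fin n → α))
    (h : ∀ t, (∀ i, t i ∈ A) → t ∉ X →
      (A.filter fun a => p (Fin.cons a t)).card ≤ if t ∈ Y then K else 0) :
    ((Fintype.piFinset fun _ : Fin (n + 1) => A).filter p).card ≤ X.card * A.card + Y.card * K := by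
  set S := (Fintype.piFinset fun _ : Fin (n + 1) => A).filter p with hS
  have hfib : ∀ t, (S.filter fun N => Fin.tail N = t).card ≤
      (A.filter fun a => p (Fin.cons a t)).card := by
    intro t
    refine Finset.card_le_card_of_injOn (fun N => N 0) ?_ ?_
    · intro N hN
      rw [Finset.mem_coe, Finset.mem_filter, hS, Finset.mem_filter, Fintype.mem_piFinset] at hN
      rw [Finset.mem_coe, Finset.mem_filter, ← hN.2, Fin.cons_self_tail]
      exact ⟨hN.1.1 0, hN.1.2⟩
    · intro N hN N' hN' h0
      rw [Finset.mem_coe, Finset.mem_filter] at hN hN'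
      rw [← Fin.cons_self_tail N, ← Fin.cons_self_tail N', hN.2, hN'.2]
      exact congrArg (fun a => (Fin.cons a t : Fin (n + 1) → α)) h0
  have hmaps : ∀ N ∈ S, Fin.tail N ∈ (X ∪ Y) := by
    intro N hN
    by_contra hc
    rw [Finset.mem_union, not_or] at hc
    rw [hS, Finset.mem_filter, Fintype.mem_piFinset] at hN
    have h1 := h (Fin.tail N) (fun i => hN.1 i.succ) hc.1
    rw [if_neg hc.2, Nat.le_zero, Finset.card_eq_zero] at h1
    exact Finset.notMem_empty (N 0) (h1 ▸ Finset.mem_filter.2 ⟨hN.1 0, by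
      rw [Fin.cons_self_tail]; exact hN.2⟩)
  have hbound : ∀ t ∈ X ∪ Y, (S.filter fun N => Fin.tail N = t).card ≤
      (if t ∈ X then A.card else 0) + if t ∈ Y then K else 0 := by
    intro t _
    rcases (S.filter fun N => Fin.tail N = t).eq_empty_or_nonempty with h0 | ⟨N, hN⟩
    · rw [h0]
      exact Nat.zero_le _
    · rw [Finset.mem_filter, hS, Finset.mem_filter, Fintype.mem_piFinset] at hN
      refine (hfib t).trans ?_
      by_cases hX : t ∈ X
      · rw [if_pos hX]
        exact (Finset.card_filter_le _ _).trans (Nat.le_add_right _ _)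
      · rw [if_neg hX, zero_add]
        exact h t (fun i => hN.2 ▸ hN.1.1 i.succ) hX
  rw [Finset.card_eq_sum_card_fiberwise hmaps]
  refine (Finset.sum_le_sum hbound).trans (le_of_eq ?_)
  rw [Finset.sum_add_distrib, Finset.sum_ite_mem, Finset.sum_ite_mem,
    Finset.inter_eq_right.2 Finset.subset_union_left,
    Finset.inter_eq_right.2 Finset.subset_union_right]
  simp

open Classical in
/-- Elimination of one variable from a family of polynomials without a common factor. -/
theorem exists_elimination {n : ℕ} {s : Finset (MvPolynomial (Fin (n + 1)) ℤ)}
    (hs : ∀ u, (∀ c ∈ s, u ∣ c) → IsUnit u) :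
    ∃ s' : Finset (MvPolynomial (Fin n) ℤ), (∀ u, (∀ c ∈ s', u ∣ c) → IsUnit u) ∧
      ∃ R : MvPolynomial (Fin n) ℤ, R ≠ 0 ∧ ∃ D : ℕ, ∀ (p : ℕ) (t : Fin n → ℤ), p.Prime →
        (∀ a : ℤ, (∀ c ∈ s, (p : ℤ) ∣ eval (Fin.cons a t) c) → (p : ℤ) ∣ eval t R) ∧
        ((¬ ∀ c ∈ s', (p : ℤ) ∣ eval t c) → ∀ (A : Finset ℤ) (a : ℤ) (L : ℕ),
          (∀ x ∈ A, a ≤ x ∧ x < a + p * L) →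
            (A.filter fun x => ∀ c ∈ s, (p : ℤ) ∣ eval (Fin.cons x t) c).card ≤ D * L) := by
  set e := MvPolynomial.finSuccEquiv ℤ n with he
  have hs2 : ∀ u, (∀ f ∈ e '' (s : Set (MvPolynomial (Fin (n + 1)) ℤ)), u ∣ f) → IsUnit u := by
    intro u hu
    rw [← MulEquiv.isUnit_map e.symm]
    refine hs _ fun c hc => ?_
    have := map_dvd e.symm (hu (e c) ⟨c, hc, rfl⟩)
    rwa [AlgEquiv.symm_apply_apply] at this
  obtain ⟨R, hR0, hR⟩ := exists_C_mem_span hs2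
  refine ⟨s.biUnion fun c => (e c).coeffs, fun u hu => ?_, R, hR0,
    s.sup fun c => (e c).natDegree, fun p t hp => ⟨fun a ha => ?_, fun hnd A a L hA => ?_⟩⟩
  · refine isUnit_of_forall_dvd_coeff hs2 (u := u) ?_
    rintro _ ⟨c, hc, rfl⟩ i
    by_cases h0 : (e c).coeff i = 0
    · rw [h0]
      exact dvd_zero _
    · exact hu _ (Finset.mem_biUnion.2 ⟨c, hc, Polynomial.coeff_mem_coeffs h0⟩)
  · set φ := (Polynomial.evalRingHom a).comp (Polynomial.mapRingHom (eval t)) with hφ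
    have h1 : Ideal.span (e '' (s : Set (MvPolynomial (Fin (n + 1)) ℤ))) ≤
        (Ideal.span {(p : ℤ)}).comap φ := by
      rw [Ideal.span_le]
      rintro _ ⟨c, hc, rfl⟩
      have := ha c hc
      rw [eval_eq_eval_mv_eval'] at this
      exact Ideal.mem_span_singleton.2 this
    have h2 := Ideal.mem_span_singleton.1 (h1 hR)
    simpa [hφ] using h2
  · push Not at hnd
    obtain ⟨c', hc', hnd⟩ := hnd
    obtain ⟨c, hc, hcc⟩ := Finset.mem_biUnion.1 hc'
    obtain ⟨i, -, rfl⟩ := Polynomial.mem_coeffs_iff.1 hcc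
    have h3 : ¬ Polynomial.C (p : ℤ) ∣ (e c).map (eval t) := by
      rw [Polynomial.C_dvd_iff_dvd_coeff]
      push Not
      exact ⟨i, by rwa [Polynomial.coeff_map]⟩
    calc _ ≤ (A.filter fun x => (p : ℤ) ∣ ((e c).map (eval t)).eval x).card := by
          refine Finset.card_le_card (Finset.monotone_filter_right _ fun x _ hx => ?_)
          rw [← eval_eq_eval_mv_eval']
          exact hx c hc
      _ ≤ _ := card_filter_dvd_eval_le hp h3 hA
      _ ≤ _ := Nat.mul_le_mul_right _ (Polynomial.natDegree_map_le.trans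
          (Finset.le_sup (f := fun c => (e c).natDegree) hc))

theorem not_forall_dvd_eval_of_isEmpty {σ : Type*} [IsEmpty σ] {s : Finset (MvPolynomial σ ℤ)}
    (hs : ∀ u, (∀ c ∈ s, u ∣ c) → IsUnit u) {p : ℕ} (hp : p.Prime) (N : σ → ℤ) :
    ¬ ∀ c ∈ s, (p : ℤ) ∣ eval N c := by
  intro h
  have h1 := (hs (C (p : ℤ)) fun c hc => by
    have := h c hc
    rw [eq_C_of_isEmpty c] at this ⊢
    rw [eval_C] at this
    exact map_dvd C this).map (eval N)
  rw [eval_C] at h1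
  exact (Nat.prime_iff_prime_int.1 hp).not_isUnit h1

open Classical in
/-- The common zeros modulo `p` of polynomials without a common factor have codimension two. -/
theorem exists_card_common_zeros_le {n : ℕ} {s : Finset (MvPolynomial (Fin n) ℤ)}
    (hs : ∀ u, (∀ c ∈ s, u ∣ c) → IsUnit u) :
    ∃ K : ℕ, ∀ p : ℕ, p.Prime →
      ((Fintype.piFinset fun _ : Fin n => Finset.Ico (0 : ℤ) p).filter fun N =>
        ∀ c ∈ s, (p : ℤ) ∣ eval N c).card * p ^ 2 ≤ K * p ^ n := by
  induction n with
  | zero =>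
    refine ⟨0, fun p hp => ?_⟩
    rw [Finset.filter_false_of_mem fun N _ => not_forall_dvd_eval_of_isEmpty hs hp N]
    simp
  | succ n ih =>
    obtain ⟨s', hs', R, hR0, D, hD⟩ := exists_elimination hs
    obtain ⟨K', hK'⟩ := ih hs'
    obtain ⟨P₀, hP₀⟩ := exists_card_dvd_eval_mul_le hR0
    refine ⟨P₀ ^ 2 + (K' + R.totalDegree * D), fun p hp => ?_⟩
    have hIco : (Finset.Ico (0 : ℤ) p).card = p := by simp
    rw [add_mul]
    rcases le_or_gt p P₀ with hle | hlt
    · refine le_trans ?_ (Nat.le_add_right _ _)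
      calc _ ≤ p ^ (n + 1) * p ^ 2 := by
            refine Nat.mul_le_mul_right _ ((Finset.card_filter_le _ _).trans ?_)
            rw [Fintype.card_piFinset_const, hIco]
        _ ≤ _ := by
            rw [mul_comm]
            exact Nat.mul_le_mul_right _ (Nat.pow_le_pow_left hle 2)
    · refine le_trans ?_ (Nat.le_add_left _ _)
      set X := (Fintype.piFinset fun _ : Fin n => Finset.Ico (0 : ℤ) p).filter fun N =>
        ∀ c ∈ s', (p : ℤ) ∣ eval N c with hX
      set Y := (Fintype.piFinset fun _ : Fin n => Finset.Ico (0 : ℤ) p).filter fun N =>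
        (p : ℤ) ∣ eval N R with hY
      have hX1 : X.card * p ^ 2 ≤ K' * p ^ n := hK' p hp
      have hY1 : Y.card * p ≤ R.totalDegree * p ^ n := hP₀ p hp hlt
      have h1 := card_filter_piFinset_succ_le (K := D) (Finset.Ico (0 : ℤ) p)
        (fun N => ∀ c ∈ s, (p : ℤ) ∣ eval N c) X Y (fun t ht htX => by
          have htX' : ¬ ∀ c ∈ s', (p : ℤ) ∣ eval t c := fun h =>
            htX (Finset.mem_filter.2 ⟨Fintype.mem_piFinset.2 ht, h⟩)
          split_ifs with htY
          · simpa using (hD p t hp).2 htX' (Finset.Ico (0 : ℤ) p) 0 1 (fun x hx => by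
              rw [Finset.mem_Ico] at hx; simpa using hx)
          · rw [Nat.le_zero, Finset.card_eq_zero]
            refine Finset.filter_false_of_mem fun a _ ha => htY ?_
            exact Finset.mem_filter.2 ⟨Fintype.mem_piFinset.2 ht, (hD p t hp).1 a ha⟩)
      rw [hIco] at h1
      calc _ ≤ (X.card * p + Y.card * D) * p ^ 2 := Nat.mul_le_mul_right _ h1
        _ = (X.card * p ^ 2) * p + (Y.card * p) * D * p := by ring
        _ ≤ (K' * p ^ n) * p + (R.totalDegree * p ^ n) * D * p := by gcongr
        _ = _ := by ring

theorem card_primeFactors_filter_le {x : ℕ} {S c d : ℕ} (hx : x ≠ 0)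
    (hS : 1 ≤ S) (hxc : x ≤ c * S ^ d) : (x.primeFactors.filter fun p => S < p).card ≤ d + c := by
  set T := x.primeFactors.filter fun p => S < p with hT
  have h1 : (S + 1) ^ T.card ≤ c * S ^ d := by
    calc (S + 1) ^ T.card = ∏ _p ∈ T, (S + 1) := by rw [Finset.prod_const]
      _ ≤ ∏ p ∈ T, p := Finset.prod_le_prod (fun _ _ => Nat.zero_le _)
          fun p hp => (Finset.mem_filter.1 hp).2
      _ ≤ x := Nat.le_of_dvd (Nat.pos_of_ne_zero hx)
          ((Finset.prod_dvd_prod_of_subset _ _ _ (Finset.filter_subset _ _)).trans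
            (Nat.prod_primeFactors_dvd x))
      _ ≤ _ := hxc
  by_contra! h
  obtain ⟨k, hk⟩ := Nat.exists_eq_add_of_lt h
  have h2 : (S + 1) ^ T.card = (S + 1) ^ d * (S + 1) ^ (c + k + 1) := by
    rw [← pow_add, hk]
    congr 1
    ring
  have h3 : c < (S + 1) ^ (c + k + 1) := by
    calc c < 2 ^ c := Nat.lt_two_pow_self
      _ ≤ (S + 1) ^ c := Nat.pow_le_pow_left (by omega) _
      _ ≤ _ := Nat.pow_le_pow_right (by omega) (by omega)
  have h4 : c * S ^ d < (S + 1) ^ d * (S + 1) ^ (c + k + 1) := by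
    calc c * S ^ d ≤ c * (S + 1) ^ d := Nat.mul_le_mul_left _ (Nat.pow_le_pow_left (by omega) _)
      _ < (S + 1) ^ (c + k + 1) * (S + 1) ^ d := Nat.mul_lt_mul_of_pos_right h3 (by positivity)
      _ = _ := mul_comm _ _
  omega

open Classical in
/-- Few points of a box are common zeros of polynomials without a common factor modulo a prime
larger than the size of the box. -/
theorem exists_card_common_zeros_large_le {n : ℕ} {s : Finset (MvPolynomial (Fin n) ℤ)}
    (hs : ∀ u, (∀ c ∈ s, u ∣ c) → IsUnit u) :
    ∃ K : ℕ, ∀ S : ℕ, 1 ≤ S →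
      ((box (Fin n) S).filter fun N => ∃ p : ℕ, p.Prime ∧ S < p ∧
        ∀ c ∈ s, (p : ℤ) ∣ eval N c).card * S ≤ K * S ^ n := by
  induction n with
  | zero =>
    refine ⟨0, fun S _ => ?_⟩
    rw [Finset.filter_false_of_mem]
    · simp
    · rintro N - ⟨p, hp, -, h⟩
      exact not_forall_dvd_eval_of_isEmpty hs hp N h
  | succ n ih =>
    obtain ⟨s', hs', R, hR0, D, hD⟩ := exists_elimination hs
    obtain ⟨K', hK'⟩ := ih hs'
    obtain ⟨c, hc⟩ := exists_abs_eval_le R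
    refine ⟨3 ^ n * R.totalDegree + 3 * K' + 3 ^ n * ((R.totalDegree + c) * (D * 2)),
      fun S hS => ?_⟩
    set X₁ := (box (Fin n) S).filter fun N => eval N R = 0 with hX₁
    set X₂ := (box (Fin n) S).filter fun N => ∃ p : ℕ, p.Prime ∧ S < p ∧
        ∀ c ∈ s', (p : ℤ) ∣ eval N c with hX₂
    have h1 : X₁.card * (2 * S + 1) ≤ R.totalDegree * (2 * S + 1) ^ n := by
      have := card_zeros_mul_le hR0 (Finset.Icc (-(S : ℤ)) S)
      rwa [card_Icc_neg] at this
    have h2 : X₂.card * S ≤ K' * S ^ n := hK' S hS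
    have h3 := card_filter_piFinset_succ_le (K := (R.totalDegree + c) * (D * 2))
      (Finset.Icc (-(S : ℤ)) S) (fun N => ∃ p : ℕ, p.Prime ∧ S < p ∧
        ∀ c ∈ s, (p : ℤ) ∣ eval N c) (X₁ ∪ X₂) (box (Fin n) S) (fun t ht htX => by
        have htb : t ∈ box (Fin n) S := Fintype.mem_piFinset.2 ht
        rw [if_pos htb]
        rw [Finset.mem_union, not_or] at htX
        have hR : eval t R ≠ 0 := fun h => htX.1 (Finset.mem_filter.2 ⟨htb, h⟩)
        have hT := card_primeFactors_filter_le (Int.natAbs_ne_zero.2 hR) hS (c := c)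
          (d := R.totalDegree) (by
            have := hc S hS t (mem_box.1 htb)
            rw [Int.abs_eq_natAbs] at this
            exact_mod_cast this)
        set T := (eval t R).natAbs.primeFactors.filter fun p => S < p with hTdef
        calc _ ≤ (T.biUnion fun p => (Finset.Icc (-(S : ℤ)) S).filter fun a =>
              ∀ c ∈ s, (p : ℤ) ∣ eval (Fin.cons a t) c).card := by
              refine Finset.card_le_card fun a ha => ?_
              rw [Finset.mem_filter] at ha
              obtain ⟨haS, p, hp, hSp, hpa⟩ := ha
              refine Finset.mem_biUnion.2 ⟨p, ?_, Finset.mem_filter.2 ⟨haS, hpa⟩⟩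
              refine Finset.mem_filter.2 ⟨Nat.mem_primeFactors.2 ⟨hp, ?_, Int.natAbs_ne_zero.2 hR⟩,
                hSp⟩
              exact Int.natCast_dvd.1 ((hD p t hp).1 a hpa)
          _ ≤ T.card * (D * 2) := by
              refine Finset.card_biUnion_le_card_mul _ _ _ fun p hp => ?_
              rw [hTdef, Finset.mem_filter] at hp
              have hpp := Nat.prime_of_mem_primeFactors hp.1
              refine (hD p t hpp).2 ?_ _ (-(S : ℤ)) 2 fun x hx => ?_
              · exact fun h => htX.2 (Finset.mem_filter.2 ⟨htb, p, hpp, hp.2, h⟩)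
              · rw [Finset.mem_Icc] at hx
                have := hp.2
                constructor <;> push_cast <;> omega
          _ ≤ _ := Nat.mul_le_mul_right _ hT)
    rw [card_Icc_neg, card_box, Fintype.card_fin] at h3
    have h4 : (2 * S + 1) ≤ 3 * S := by omega
    have h5 : (2 * S + 1) ^ n ≤ 3 ^ n * S ^ n := by
      rw [← mul_pow]
      exact Nat.pow_le_pow_left h4 n
    calc _ ≤ ((X₁ ∪ X₂).card * (2 * S + 1) +
          (2 * S + 1) ^ n * ((R.totalDegree + c) * (D * 2))) * S := Nat.mul_le_mul_right _ h3
      _ ≤ ((X₁.card + X₂.card) * (2 * S + 1) +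
          (2 * S + 1) ^ n * ((R.totalDegree + c) * (D * 2))) * S := by
          gcongr
          exact Finset.card_union_le _ _
      _ = (X₁.card * (2 * S + 1)) * S + (X₂.card * S) * (2 * S + 1) +
          (2 * S + 1) ^ n * ((R.totalDegree + c) * (D * 2)) * S := by ring
      _ ≤ (R.totalDegree * (3 ^ n * S ^ n)) * S + (K' * S ^ n) * (3 * S) +
          (3 ^ n * S ^ n) * ((R.totalDegree + c) * (D * 2)) * S := by
          refine Nat.add_le_add (Nat.add_le_add (Nat.mul_le_mul_right _ ?_)
            (Nat.mul_le_mul h2 h4)) (Nat.mul_le_mul_right _ (Nat.mul_le_mul_right _ h5))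
          exact h1.trans (Nat.mul_le_mul_left _ h5)
      _ = _ := by ring

theorem dvd_eval_of_modEq {σ : Type*} {p : ℤ} {N N' : σ → ℤ} (h : ∀ i, N i ≡ N' i [ZMOD p])
    {c : MvPolynomial σ ℤ} (hc : p ∣ eval N c) : p ∣ eval N' c := by
  have h1 : ∀ c : MvPolynomial σ ℤ, eval N c ≡ eval N' c [ZMOD p] := by
    intro c
    induction c using MvPolynomial.induction_on with
    | C a => rw [eval_C, eval_C]
    | add f g hf hg =>
      rw [map_add, map_add]
      exact hf.add hg
    | mul_X f i hf =>
      rw [map_mul, map_mul, eval_X, eval_X]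
      exact hf.mul (h i)
  exact (h1 c).dvd_iff.1 hc

open Classical in
theorem card_residue_le {r : ℕ} {p Q T L : ℕ} (hp : 0 < p) (hpQ : IsCoprime (Q : ℤ) p)
    (hL : 2 * T + 1 ≤ p * L) (a : Fin r → ℤ) {b : (Fin r → ℤ) → Prop}
    (hb : ∀ N N', (∀ i, N i ≡ N' i [ZMOD p]) → b N → b N') :
    ((box (Fin r) T).filter fun s => b fun i => a i + Q * s i).card ≤
      ((Fintype.piFinset fun _ : Fin r => Finset.Ico (0 : ℤ) p).filter b).card * L ^ r := by
  have hp0 : (0 : ℤ) < p := by exact_mod_cast hp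
  calc _ ≤ (((Fintype.piFinset fun _ : Fin r => Finset.Ico (0 : ℤ) p).filter b) ×ˢ
        Fintype.piFinset fun _ : Fin r => Finset.Ico (0 : ℤ) L).card := by
        refine Finset.card_le_card_of_injOn (fun s => (fun i => (a i + Q * s i) % p,
          fun i => (s i + T) / p)) ?_ ?_
        · intro s hs
          rw [Finset.mem_coe, Finset.mem_filter, mem_box] at hs
          rw [Finset.mem_coe, Finset.mem_product, Finset.mem_filter, Fintype.mem_piFinset,
            Fintype.mem_piFinset]
          refine ⟨⟨fun i => Finset.mem_Ico.2 ⟨Int.emod_nonneg _ hp0.ne', Int.emod_lt_of_pos _ hp0⟩,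
            hb _ _ (fun i => (Int.mod_modEq _ _).symm) hs.2⟩, fun i => Finset.mem_Ico.2 ?_⟩
          have := abs_le.1 (hs.1 i)
          have hL' : 2 * (T : ℤ) + 1 ≤ p * L := by exact_mod_cast hL
          exact ⟨Int.ediv_nonneg (by linarith) hp0.le,
            Int.ediv_lt_of_lt_mul hp0 (by linarith)⟩
        · intro s _ s' _ h
          rw [Prod.mk.injEq] at h
          funext i
          have h1 : a i + Q * s i ≡ a i + Q * s' i [ZMOD p] := congrFun h.1 i
          have h2 : (p : ℤ) ∣ Q * (s' i - s i) := by
            have := h1.dvd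
            rwa [add_sub_add_left_eq_sub, ← mul_sub] at this
          have h3 : s i + T ≡ s' i + T [ZMOD p] :=
            (Int.modEq_iff_dvd.2 (hpQ.symm.dvd_of_dvd_mul_left h2)).add_right _
          have h4 := congrFun h.2 i
          have h5 := Int.emod_add_mul_ediv (s i + T) p
          have h6 := Int.emod_add_mul_ediv (s' i + T) p
          rw [h4, h3] at h5
          linarith
    _ = _ := by rw [Finset.card_product, Fintype.card_piFinset_const]; simp

/-- Simultaneous solution of residue conditions modulo all primes up to `M`. -/
theorem exists_crt {r : ℕ} (M : ℕ) (N : ℕ → Fin r → ℤ) :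
    ∃ Q : ℕ, 0 < Q ∧ (∀ p, p.Prime → p ≤ M → p ∣ Q) ∧ (∀ p, p.Prime → M < p → p.Coprime Q) ∧
      ∃ a : Fin r → ℕ, (∀ i, a i < Q) ∧ ∀ p, p.Prime → p ≤ M → ∀ i, (a i : ℤ) ≡ N p i [ZMOD p] := by
  set t := (Finset.range (M + 1)).filter Nat.Prime with ht
  have htp : ∀ p ∈ t, p.Prime := fun p hp => (Finset.mem_filter.1 hp).2
  have hmem : ∀ p, p.Prime → p ≤ M → p ∈ t := fun p hp hpM =>
    Finset.mem_filter.2 ⟨Finset.mem_range.2 (by omega), hp⟩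
  have hs : ∀ p ∈ t, (id p : ℕ) ≠ 0 := fun p hp => (htp p hp).ne_zero
  have pp : (t : Set ℕ).Pairwise (Function.onFun Nat.Coprime id) := fun p hp q hq hpq =>
    (Nat.coprime_primes (htp p hp) (htp q hq)).2 hpq
  refine ⟨∏ p ∈ t, p, Finset.prod_pos fun p hp => (htp p hp).pos, fun p hp hpM =>
    Finset.dvd_prod_of_mem _ (hmem p hp hpM), fun p hp hpM => ?_,
    fun i => Nat.chineseRemainderOfFinset (fun p => (N p i % p).toNat) id t hs pp,
    fun i => Nat.chineseRemainderOfFinset_lt_prod _ _ _ _, fun p hp hpM i => ?_⟩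
  · refine Nat.Coprime.prod_right fun q hq => (Nat.coprime_primes hp (htp q hq)).2 ?_
    rintro rfl
    have := Finset.mem_range.1 (Finset.mem_filter.1 hq).1
    omega
  · have h1 := (Nat.chineseRemainderOfFinset (fun p => (N p i % p).toNat) id t hs pp).2 p
      (hmem p hp hpM)
    have h2 := Int.natCast_modEq_iff.2 h1
    refine h2.trans ?_
    rw [Int.toNat_of_nonneg (Int.emod_nonneg _ (by exact_mod_cast hp.ne_zero))]
    exact Int.mod_modEq _ _

open Classical in
/-- A sieve: if for each prime `p` the bad residues modulo `p` are not everything, have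
codimension two, and are negligible for large `p`, then a positive proportion of the points is good
at all primes. -/
theorem eventually_le_card_sieve {r : ℕ} {b : ℕ → (Fin r → ℤ) → Prop}
    (hb : ∀ (p : ℕ) (N N' : Fin r → ℤ), (∀ i, N i ≡ N' i [ZMOD p]) → b p N → b p N')
    (hb0 : ∀ p, p.Prime → ∃ N, ¬ b p N) {K₁ K₂ : ℕ}
    (h1 : ∀ p : ℕ, p.Prime → ((Fintype.piFinset fun _ : Fin r => Finset.Ico (0 : ℤ) p).filter
      (b p)).card * p ^ 2 ≤ K₁ * p ^ r)
    (h2 : ∀ S : ℕ, 1 ≤ S → ((box (Fin r) S).filter fun N =>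
      ∃ p : ℕ, p.Prime ∧ S < p ∧ b p N).card * S ≤ K₂ * S ^ r) :
    ∃ κ : ℝ, 0 < κ ∧ ∀ᶠ B : ℕ in atTop, κ * (2 * B + 1) ^ r ≤
      (((box (Fin r) B).filter fun N => ∀ p : ℕ, p.Prime → ¬ b p N).card : ℝ) := by
  choose! N hN using hb0
  set M := 4 * (4 ^ r * K₁) + 1 with hM
  obtain ⟨Q, hQ0, hQdvd, hcop, a, haQ, ha⟩ := exists_crt M N
  set E := 4 * ((2 ^ r * K₁ + K₂) * (3 * Q) ^ r) + M with hE
  refine ⟨1 / (2 * (9 * Q) ^ r), by positivity, ?_⟩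
  filter_upwards [eventually_ge_atTop (Q * (E + 1))] with B hB
  set T := B / Q - 1 with hT
  have hdiv : E + 1 ≤ B / Q := (Nat.le_div_iff_mul_le hQ0).2 (by rwa [mul_comm])
  have hET : E ≤ T := by omega
  have hMT : M ≤ T := by omega
  have hT1 : 1 ≤ T := by omega
  have hTB : Q * (T + 1) ≤ B := by
    have : T + 1 = B / Q := by omega
    rw [this]
    exact Nat.mul_div_le B Q
  have hBT : B ≤ 3 * Q * T := by
    have h3 : T + 2 = B / Q + 1 := by omega
    have h4 := Nat.lt_mul_div_succ B hQ0
    rw [← h3] at h4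
    nlinarith
  have hTB' : T ≤ B := by nlinarith
  set f : (Fin r → ℤ) → Fin r → ℤ := fun s i => a i + Q * s i with hf
  have hfinj : Function.Injective f := by
    intro s s' h
    funext i
    have := congrFun h i
    simp only [hf, add_right_inj] at this
    exact mul_left_cancel₀ (by exact_mod_cast hQ0.ne') this
  have hfbox : ∀ s ∈ box (Fin r) T, f s ∈ box (Fin r) B := by
    intro s hs
    rw [mem_box] at hs ⊢
    intro i
    have h3 := abs_le.1 (hs i)
    have h4 : (a i : ℤ) ≤ Q := by exact_mod_cast (haQ i).le
    have h5 : (0 : ℤ) ≤ a i := by positivity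
    have h6 : (Q : ℤ) * (T + 1) ≤ B := by exact_mod_cast hTB
    have h7 : (0 : ℤ) < Q := by exact_mod_cast hQ0
    rw [abs_le]
    constructor <;> simp only [hf] <;> nlinarith
  set G := (box (Fin r) B).filter fun N => ∀ p : ℕ, p.Prime → ¬ b p N with hG
  set A : ℕ → Finset (Fin r → ℤ) := fun p =>
    (box (Fin r) T).filter fun s => p.Prime ∧ b p (f s) with hA
  set A' := (box (Fin r) T).filter fun s => ∃ p : ℕ, p.Prime ∧ B < p ∧ b p (f s) with hA'
  have hcover : (box (Fin r) T).card ≤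
      G.card + (∑ p ∈ Finset.Ioc M T, (A p).card + ∑ p ∈ Finset.Ioc T B, (A p).card + A'.card) := by
    have h3 : ((box (Fin r) T).filter fun s => ∀ p : ℕ, p.Prime → ¬ b p (f s)).card ≤ G.card := by
      refine Finset.card_le_card_of_injOn f (fun s hs => ?_) hfinj.injOn
      rw [Finset.mem_coe, Finset.mem_filter] at hs
      exact Finset.mem_filter.2 ⟨hfbox s hs.1, hs.2⟩
    have h4 : ((box (Fin r) T).filter fun s => ¬ ∀ p : ℕ, p.Prime → ¬ b p (f s)) ⊆
        ((Finset.Ioc M T).biUnion A ∪ (Finset.Ioc T B).biUnion A) ∪ A' := by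
      intro s hs
      rw [Finset.mem_filter] at hs
      obtain ⟨hs, h⟩ := hs
      push Not at h
      obtain ⟨p, hp, hbp⟩ := h
      have hsA : s ∈ A p := Finset.mem_filter.2 ⟨hs, hp, hbp⟩
      have hpM : M < p := by
        by_contra! hpM
        refine hN p hp (hb p _ _ (fun i => ?_) hbp)
        have h5 : (p : ℤ) ∣ Q := by exact_mod_cast hQdvd p hp hpM
        have h6 : (a i : ℤ) + Q * s i ≡ a i + 0 [ZMOD p] :=
          Int.ModEq.add_left _ (Int.modEq_zero_iff_dvd.2 (h5.mul_right _))
        rw [add_zero] at h6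
        exact h6.trans (ha p hp hpM i)
      rw [Finset.mem_union, Finset.mem_union, Finset.mem_biUnion, Finset.mem_biUnion]
      rcases le_or_gt p T with hpT | hpT
      · exact Or.inl (Or.inl ⟨p, Finset.mem_Ioc.2 ⟨hpM, hpT⟩, hsA⟩)
      rcases le_or_gt p B with hpB | hpB
      · exact Or.inl (Or.inr ⟨p, Finset.mem_Ioc.2 ⟨hpT, hpB⟩, hsA⟩)
      · exact Or.inr (Finset.mem_filter.2 ⟨hs, p, hp, hpB, hbp⟩)
    have h5 := (Finset.card_le_card h4).trans (Finset.card_union_le _ _)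
    have h6 := Finset.card_union_le ((Finset.Ioc M T).biUnion A) ((Finset.Ioc T B).biUnion A)
    have h7 := Finset.card_biUnion_le (s := Finset.Ioc M T) (t := A)
    have h8 := Finset.card_biUnion_le (s := Finset.Ioc T B) (t := A)
    have h9 := Finset.card_filter_add_card_filter_not (s := box (Fin r) T)
      (fun s => ∀ p : ℕ, p.Prime → ¬ b p (f s))
    omega
  have hAp : ∀ p L k Y : ℕ, M < p → 2 * T + 1 ≤ p * L → p * L ≤ k * Y →
      ((A p).card : ℝ) ≤ K₁ * (k ^ r * (Y : ℝ) ^ r) * ((p : ℝ) ^ 2)⁻¹ := by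
    intro p L k Y hpM hL hLY
    by_cases hp : p.Prime
    · have h3 := card_residue_le hp.pos
        (Nat.isCoprime_iff_coprime.2 (hcop p hp hpM).symm) hL (fun i => (a i : ℤ)) (hb p)
      have h4 : (A p).card ≤ ((box (Fin r) T).filter fun s =>
          b p fun i => (a i : ℤ) + Q * s i).card :=
        Finset.card_le_card (Finset.monotone_filter_right _ fun s _ hs => hs.2)
      have h5 : (A p).card * p ^ 2 ≤ K₁ * (k ^ r * Y ^ r) := by
        refine (Nat.mul_le_mul_right _ (h4.trans h3)).trans ?_
        rw [mul_right_comm]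
        refine (Nat.mul_le_mul_right _ (h1 p hp)).trans ?_
        rw [mul_assoc, ← mul_pow, ← mul_pow]
        exact Nat.mul_le_mul_left _ (Nat.pow_le_pow_left hLY r)
      have hp0 : (0 : ℝ) < (p : ℝ) ^ 2 := by have := hp.pos; positivity
      rw [← div_eq_mul_inv, le_div_iff₀ hp0]
      exact_mod_cast h5
    · have : A p = ∅ := Finset.filter_false_of_mem fun s _ hs => hp hs.1
      rw [this]
      simp only [Finset.card_empty, Nat.cast_zero]
      positivity
  have hT0 : (0 : ℝ) < T := by exact_mod_cast hT1
  have hBr : (B : ℝ) ^ r ≤ (3 * Q) ^ r * T ^ r := by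
    rw [← mul_pow]
    exact pow_le_pow_left₀ (by positivity) (by exact_mod_cast hBT) r
  have hsum1 : (∑ p ∈ Finset.Ioc M T, ((A p).card : ℝ)) ≤ T ^ r / 4 := by
    calc (∑ p ∈ Finset.Ioc M T, ((A p).card : ℝ))
        ≤ ∑ p ∈ Finset.Ioc M T, K₁ * (4 ^ r * (T : ℝ) ^ r) * ((p : ℝ) ^ 2)⁻¹ := by
          refine Finset.sum_le_sum fun p hp => ?_
          rw [Finset.mem_Ioc] at hp
          have hp0 : 0 < p := by omega
          have h3 := Nat.lt_mul_div_succ (3 * T) hp0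
          have h4 : p * (3 * T / p + 1) ≤ 4 * T := by
            have := Nat.mul_div_le (3 * T) p
            rw [mul_add]
            omega
          exact_mod_cast hAp p (3 * T / p + 1) 4 T hp.1 (by omega) h4
      _ = K₁ * (4 ^ r * (T : ℝ) ^ r) * ∑ p ∈ Finset.Ioc M T, ((p : ℝ) ^ 2)⁻¹ := by
          rw [Finset.mul_sum]
      _ ≤ K₁ * (4 ^ r * (T : ℝ) ^ r) * (M : ℝ)⁻¹ := by
          gcongr
          exact (sum_Ioc_inv_sq_le_sub (by omega) hMT).trans (sub_le_self _ (by positivity))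
      _ ≤ T ^ r / 4 := by
          have hM' : (M : ℝ) = 4 * (4 ^ r * K₁) + 1 := by rw [hM]; push_cast; ring
          have hM0 : (0 : ℝ) < M := by rw [hM']; positivity
          rw [← div_eq_mul_inv, div_le_iff₀ hM0, hM']
          have : (0 : ℝ) ≤ T ^ r := by positivity
          nlinarith
  have hsum2 : (∑ p ∈ Finset.Ioc T B, ((A p).card : ℝ)) ≤ K₁ * (2 ^ r * (B : ℝ) ^ r) / T := by
    calc (∑ p ∈ Finset.Ioc T B, ((A p).card : ℝ))
        ≤ ∑ p ∈ Finset.Ioc T B, K₁ * (2 ^ r * (B : ℝ) ^ r) * ((p : ℝ) ^ 2)⁻¹ := by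
          refine Finset.sum_le_sum fun p hp => ?_
          rw [Finset.mem_Ioc] at hp
          exact_mod_cast hAp p 2 2 B (by omega) (by omega) (by omega)
      _ = K₁ * (2 ^ r * (B : ℝ) ^ r) * ∑ p ∈ Finset.Ioc T B, ((p : ℝ) ^ 2)⁻¹ := by
          rw [Finset.mul_sum]
      _ ≤ K₁ * (2 ^ r * (B : ℝ) ^ r) * (T : ℝ)⁻¹ := by
          gcongr
          exact (sum_Ioc_inv_sq_le_sub (by omega) hTB').trans (sub_le_self _ (by positivity))
      _ = _ := by rw [div_eq_mul_inv]
  have hlarge : (A'.card : ℝ) ≤ K₂ * (B : ℝ) ^ r / T := by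
    have h3 : A'.card ≤ ((box (Fin r) B).filter fun N =>
        ∃ p : ℕ, p.Prime ∧ B < p ∧ b p N).card := by
      refine Finset.card_le_card_of_injOn f (fun s hs => ?_) hfinj.injOn
      rw [Finset.mem_coe, Finset.mem_filter] at hs
      exact Finset.mem_filter.2 ⟨hfbox s hs.1, hs.2⟩
    have h4 : A'.card * T ≤ K₂ * B ^ r :=
      (Nat.mul_le_mul h3 hTB').trans (h2 B (by omega))
    rw [le_div_iff₀ hT0]
    exact_mod_cast h4
  have hE' : (4 * ((2 ^ r * K₁ + K₂) * (3 * Q) ^ r) : ℝ) ≤ T := by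
    have : 4 * ((2 ^ r * K₁ + K₂) * (3 * Q) ^ r) ≤ T := by omega
    exact_mod_cast this
  have hrest : K₁ * (2 ^ r * (B : ℝ) ^ r) / T + K₂ * (B : ℝ) ^ r / T ≤ T ^ r / 4 := by
    rw [← add_div, div_le_iff₀ hT0]
    calc K₁ * (2 ^ r * (B : ℝ) ^ r) + K₂ * (B : ℝ) ^ r
        = (2 ^ r * K₁ + K₂) * (B : ℝ) ^ r := by ring
      _ ≤ (2 ^ r * K₁ + K₂) * ((3 * Q) ^ r * T ^ r) := by gcongr
      _ = (4 * ((2 ^ r * K₁ + K₂) * (3 * Q) ^ r)) * (T ^ r / 4) := by ring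
      _ ≤ T * (T ^ r / 4) := by gcongr
      _ = _ := mul_comm _ _
  have hcover' : ((2 : ℝ) * T + 1) ^ r ≤ G.card + (∑ p ∈ Finset.Ioc M T, ((A p).card : ℝ) +
      ∑ p ∈ Finset.Ioc T B, ((A p).card : ℝ) + A'.card) := by
    rw [card_box, Fintype.card_fin] at hcover
    exact_mod_cast hcover
  have hTT : (T : ℝ) ^ r ≤ (2 * T + 1) ^ r := by
    gcongr
    linarith
  have hGT : (T : ℝ) ^ r / 2 ≤ G.card := by linarith
  refine le_trans ?_ hGT
  have hBB : (2 * (B : ℝ) + 1) ^ r ≤ (9 * Q) ^ r * T ^ r := by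
    rw [← mul_pow]
    have : 2 * B + 1 ≤ 9 * Q * T := by
      have : 3 * (3 * Q * T) = 9 * Q * T := by ring
      omega
    exact pow_le_pow_left₀ (by positivity) (by exact_mod_cast this) r
  rw [div_mul_eq_mul_div, one_mul, div_le_div_iff₀ (by positivity) two_pos]
  nlinarith

theorem card_filter_mul_le_of_exists {ι α : Type*} [Fintype ι] {s : Finset α} {b : α → Prop}
    {q : ι → α → Prop} {_ : DecidablePred b} {_ : ∀ j, DecidablePred (q j)}
    (hb : ∀ x, b x → ∃ j, q j x)
    {K : ι → ℕ} {t z : ℕ} (h : ∀ j, (s.filter (q j)).card * t ≤ K j * z) :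
    (s.filter b).card * t ≤ (∑ j, K j) * z := by
  classical
  have h1 : s.filter b ⊆ Finset.univ.biUnion fun j => s.filter (q j) := by
    intro x hx
    obtain ⟨hx, hbx⟩ := Finset.mem_filter.1 hx
    obtain ⟨j, hj⟩ := hb x hbx
    exact Finset.mem_biUnion.2 ⟨j, Finset.mem_univ j, Finset.mem_filter.2 ⟨hx, hj⟩⟩
  refine (Nat.mul_le_mul_right t ((Finset.card_le_card h1).trans Finset.card_biUnion_le)).trans ?_
  rw [Finset.sum_mul, Finset.sum_mul]
  exact Finset.sum_le_sum fun j _ => h j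

open Classical in
/-- The coefficients of `P`, viewed as a polynomial in the variables `y`. -/
noncomputable def yCoeffs {r m : ℕ} (P : MvPolynomial (Fin r ⊕ Fin m) ℤ) :
    Finset (MvPolynomial (Fin r) ℤ) :=
  (toY r m P).support.image fun μ => coeff μ (toY r m P)

theorem C_dvd_toY {r m : ℕ} {P : MvPolynomial (Fin r ⊕ Fin m) ℤ} {u : MvPolynomial (Fin r) ℤ}
    (h : ∀ c ∈ yCoeffs P, u ∣ c) : C u ∣ toY r m P := by
  classical
  rw [C_dvd_iff_dvd_coeff]
  intro μ
  by_cases hμ : μ ∈ (toY r m P).support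
  · exact h _ (Finset.mem_image_of_mem _ hμ)
  · rw [notMem_support_iff.1 hμ]
    exact dvd_zero u

theorem isUnit_of_forall_dvd_yCoeffs {r m : ℕ} {P : MvPolynomial (Fin r ⊕ Fin m) ℤ}
    (hP : Irreducible P) (hdeg : ∃ d ∈ P.support, ∃ i : Fin m, d (Sum.inr i) ≠ 0)
    {u : MvPolynomial (Fin r) ℤ} (h : ∀ c ∈ yCoeffs P, u ∣ c) : IsUnit u := by
  obtain ⟨g, hg⟩ := C_dvd_toY h
  have hirr : Irreducible (toY r m P) := (MulEquiv.irreducible_iff (toY r m)).2 hP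
  rcases hirr.isUnit_or_isUnit hg with hu | hu
  · exact by simpa using hu.map (constantCoeff (R := MvPolynomial (Fin r) ℤ))
  · obtain ⟨x, -, hx⟩ := isUnit_iff_eq_C_of_isReduced.1 hu
    have := one_le_totalDegree_toY hdeg
    rw [hg, hx, ← C_mul, totalDegree_C] at this
    omega

theorem C_dvd_specX_iff {r m : ℕ} {P : MvPolynomial (Fin r ⊕ Fin m) ℤ} {n : Fin r → ℤ} {p : ℤ} :
    C p ∣ specX r m n P ↔ ∀ c ∈ yCoeffs P, p ∣ eval n c := by
  classical
  rw [specX_eq_map, C_dvd_iff_dvd_coeff]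
  simp only [coeff_map]
  constructor
  · intro h c hc
    obtain ⟨μ, -, rfl⟩ := Finset.mem_image.1 hc
    exact h μ
  · intro h μ
    by_cases hμ : μ ∈ (toY r m P).support
    · exact h _ (Finset.mem_image_of_mem _ hμ)
    · rw [notMem_support_iff.1 hμ, map_zero]
      exact dvd_zero p

open Classical in
/-- For a positive proportion of the points `n`, no prime divides any of the `P_j(n, y)`. -/
theorem eventually_le_card_forall_not_dvd {r m : ℕ} {ι : Type*} [Fintype ι]
    {P : ι → MvPolynomial (Fin r ⊕ Fin m) ℤ} (hirr : ∀ j, Irreducible (P j))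
    (hdeg : ∀ j, ∃ d ∈ (P j).support, ∃ i : Fin m, d (Sum.inr i) ≠ 0)
    (hnofix : ¬ ∃ p : ℕ, p.Prime ∧ ∀ n : Fin r → ℤ,
      (C (p : ℤ) : MvPolynomial (Fin m) ℤ) ∣ ∏ j, specX r m n (P j)) :
    ∃ κ : ℝ, 0 < κ ∧ ∀ᶠ B : ℕ in atTop, κ * (2 * B + 1) ^ r ≤
      (((box (Fin r) B).filter fun n =>
        ∀ p : ℕ, p.Prime → ∀ j, ¬ C (p : ℤ) ∣ specX r m n (P j)).card : ℝ) := by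
  have hs : ∀ j, ∀ u, (∀ c ∈ yCoeffs (P j), u ∣ c) → IsUnit u :=
    fun j u => isUnit_of_forall_dvd_yCoeffs (hirr j) (hdeg j)
  choose K₁ hK₁ using fun j => exists_card_common_zeros_le (hs j)
  choose K₂ hK₂ using fun j => exists_card_common_zeros_large_le (hs j)
  set b : ℕ → (Fin r → ℤ) → Prop := fun p N => ∃ j, ∀ c ∈ yCoeffs (P j), (p : ℤ) ∣ eval N c with hb
  have hb0 : ∀ p : ℕ, p.Prime → ∃ N, ¬ b p N := by
    intro p hp
    by_contra! hall
    refine hnofix ⟨p, hp, fun n => ?_⟩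
    obtain ⟨j, hj⟩ := hall n
    exact (C_dvd_specX_iff.2 hj).trans (Finset.dvd_prod_of_mem _ (Finset.mem_univ j))
  obtain ⟨κ, hκ, h⟩ := eventually_le_card_sieve (K₁ := ∑ j, K₁ j) (K₂ := ∑ j, K₂ j)
    (fun p N N' hN ⟨j, hj⟩ => ⟨j, fun c hc => dvd_eval_of_modEq hN (hj c hc)⟩) hb0
    (fun p hp => card_filter_mul_le_of_exists (fun N hN => hN) fun j => hK₁ j p hp)
    (fun S hS => card_filter_mul_le_of_exists
      (fun N ⟨p, hp, hpS, j, hj⟩ => ⟨j, p, hp, hpS, hj⟩) fun j => hK₂ j S hS)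
  refine ⟨κ, hκ, h.mono fun B hB => hB.trans (Nat.cast_le.2 (Finset.card_le_card
    (Finset.monotone_filter_right _ ?_)))⟩
  exact fun n _ hn p hp j hj => hn p hp ⟨j, C_dvd_specX_iff.1 hj⟩

open Classical in
theorem eventually_le_card_irreducible {r m : ℕ} {ι : Type*} [Fintype ι]
    {P : ι → MvPolynomial (Fin r ⊕ Fin m) ℤ} (hirr : ∀ j, Irreducible (P j))
    (hdeg : ∀ j, ∃ d ∈ (P j).support, ∃ i : Fin m, d (Sum.inr i) ≠ 0)
    (hnofix : ¬ ∃ p : ℕ, p.Prime ∧ ∀ n : Fin r → ℤ,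
      (C (p : ℤ) : MvPolynomial (Fin m) ℤ) ∣ ∏ j, specX r m n (P j)) :
    ∃ κ : ℝ, 0 < κ ∧ ∀ᶠ B : ℕ in atTop, κ * (2 * B + 1) ^ r ≤
      (((box (Fin r) B).filter fun n => ∀ j, Irreducible (specX r m n (P j))).card : ℝ) := by
  obtain ⟨κ, hκ, h⟩ := eventually_le_card_forall_not_dvd hirr hdeg hnofix
  set ε : ℝ := κ / (2 * (Fintype.card ι + 1)) with hε
  have hε0 : 0 < ε := by positivity
  have h1 := eventually_all.2 fun j => eventually_card_not_irreducible_le (hirr j) (hdeg j) hε0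
  refine ⟨κ / 2, by positivity, ?_⟩
  filter_upwards [h, h1] with B hB hB1
  set D : ι → Finset (Fin r → ℤ) := fun j => (box (Fin r) B).filter fun n =>
    (∀ p : ℕ, p.Prime → ¬ C (p : ℤ) ∣ specX r m n (P j)) ∧ ¬ Irreducible (specX r m n (P j))
    with hD
  have h2 : ((box (Fin r) B).filter fun n =>
        ∀ p : ℕ, p.Prime → ∀ j, ¬ C (p : ℤ) ∣ specX r m n (P j)) ⊆
      ((box (Fin r) B).filter fun n => ∀ j, Irreducible (specX r m n (P j))) ∪
        Finset.univ.biUnion D := by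
    intro n hn
    obtain ⟨hn, hp⟩ := Finset.mem_filter.1 hn
    rw [Finset.mem_union, Finset.mem_biUnion]
    by_cases hall : ∀ j, Irreducible (specX r m n (P j))
    · exact Or.inl (Finset.mem_filter.2 ⟨hn, hall⟩)
    · push Not at hall
      obtain ⟨j, hj⟩ := hall
      exact Or.inr ⟨j, Finset.mem_univ j,
        Finset.mem_filter.2 ⟨hn, fun p hpp => hp p hpp j, hj⟩⟩
  have h3 := (Finset.card_le_card h2).trans ((Finset.card_union_le _ _).trans
    (Nat.add_le_add_left Finset.card_biUnion_le _))
  have h4 : ((∑ j, (D j).card : ℕ) : ℝ) ≤ Fintype.card ι * (ε * (2 * B + 1) ^ r) := by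
    rw [Nat.cast_sum, ← nsmul_eq_mul]
    exact Finset.sum_le_card_nsmul _ _ _ fun j _ => hB1 j
  have h5 : Fintype.card ι * ε ≤ κ / 2 := by
    rw [hε, mul_div_assoc', div_le_div_iff₀ (by positivity) two_pos]
    nlinarith
  have h6 := mul_le_mul_of_nonneg_right h5 (by positivity : (0 : ℝ) ≤ (2 * B + 1) ^ r)
  have h7 := hB.trans (Nat.cast_le.2 h3)
  rw [Nat.cast_add] at h7
  linarith

open Classical in
theorem card_filter_eval_eq_zero_mul_le {r : ℕ} {Q : MvPolynomial (Fin r) ℚ} (hQ : Q ≠ 0) (B : ℕ) :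
    ((box (Fin r) B).filter fun n => eval (fun i => (n i : ℚ)) Q = 0).card * (2 * B + 1) ≤
      Q.totalDegree * (2 * B + 1) ^ r := by
  have h := card_zeros_mul_le hQ
    ((Finset.Icc (-(B : ℤ)) B).map ⟨_, Int.cast_injective (α := ℚ)⟩)
  rw [Finset.card_map, card_Icc_neg] at h
  refine (Nat.mul_le_mul_right _ ?_).trans h
  refine Finset.card_le_card_of_injOn (fun n i => (n i : ℚ)) (fun n hn => ?_) ?_
  · obtain ⟨hn, hz⟩ := Finset.mem_filter.1 (Finset.mem_coe.1 hn)
    rw [box, Fintype.mem_piFinset] at hn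
    exact Finset.mem_coe.2 (Finset.mem_filter.2
      ⟨Fintype.mem_piFinset.2 fun i => Finset.mem_map.2 ⟨n i, hn i, rfl⟩, hz⟩)
  · intro n _ n' _ hnn
    funext i
    exact Int.cast_injective (congrFun hnn i)

/-- If `H` contains a positive proportion of every large cube, then it has positive lower
density. -/
theorem liminf_card_pos {r : ℕ} {H : (Fin r → ℤ) → Prop} {_ : DecidablePred H} {κ : ℝ} (hκ : 0 < κ)
    (h : ∀ᶠ B : ℕ in atTop, κ * (2 * B + 1) ^ r ≤ (((box (Fin r) B).filter H).card : ℝ)) :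
    0 < liminf (fun B : ℕ =>
      (Nat.card {n : Fin r → ℤ // (∀ i, -(B : ℤ) ≤ n i ∧ n i ≤ (B : ℤ)) ∧ H n} : ℝ) /
        (2 * (B : ℝ) + 1) ^ r) atTop := by
  have hcard : ∀ B : ℕ, Nat.card {n : Fin r → ℤ // (∀ i, -(B : ℤ) ≤ n i ∧ n i ≤ (B : ℤ)) ∧ H n} =
      ((box (Fin r) B).filter H).card :=
    fun B => Nat.subtype_card _ fun n => by simp [mem_box, abs_le]
  simp only [hcard]
  refine hκ.trans_le (le_liminf_of_le (IsBoundedUnder.isCoboundedUnder_ge ⟨1, ?_⟩) ?_)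
  · rw [eventually_map]
    refine Eventually.of_forall fun B => div_le_one_of_le₀ ?_ (by positivity)
    have h1 := Finset.card_filter_le (box (Fin r) B) H
    rw [card_box, Fintype.card_fin] at h1
    exact_mod_cast h1
  · filter_upwards [h] with B hB
    rwa [le_div_iff₀ (by positivity)]

/-- If `H` contains a positive proportion of every large cube, then it is Zariski-dense. -/
theorem exists_eval_ne_zero_of_card {r : ℕ} {H : (Fin r → ℤ) → Prop} {_ : DecidablePred H} {κ : ℝ}
    (hκ : 0 < κ)
    (h : ∀ᶠ B : ℕ in atTop, κ * (2 * B + 1) ^ r ≤ (((box (Fin r) B).filter H).card : ℝ))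
    {Q : MvPolynomial (Fin r) ℚ} (hQ : Q ≠ 0) :
    ∃ n : Fin r → ℤ, H n ∧ eval (fun i => (n i : ℚ)) Q ≠ 0 := by
  obtain ⟨B, hB, hBQ⟩ := (h.and (eventually_gt_atTop ⌈Q.totalDegree / κ⌉₊)).exists
  by_contra! hall
  have h1 : ((box (Fin r) B).filter H).card ≤
      ((box (Fin r) B).filter fun n => eval (fun i => (n i : ℚ)) Q = 0).card :=
    Finset.card_le_card (Finset.monotone_filter_right _ fun n _ hn => hall n hn)
  have h2 : (((box (Fin r) B).filter fun n => eval (fun i => (n i : ℚ)) Q = 0).card : ℝ) *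
      (2 * B + 1) ≤ Q.totalDegree * (2 * B + 1) ^ r := by
    exact_mod_cast card_filter_eval_eq_zero_mul_le hQ B
  have h3 := mul_le_mul_of_nonneg_right (hB.trans (Nat.cast_le.2 h1))
    (by positivity : (0 : ℝ) ≤ 2 * B + 1)
  have h4 : (0 : ℝ) < (2 * B + 1) ^ r := by positivity
  have h5 : (Q.totalDegree : ℝ) < κ * B := by
    rw [← div_lt_iff₀' hκ]
    exact Nat.lt_of_ceil_lt hBQ
  have h6 := mul_lt_mul_of_pos_right h5 h4
  nlinarith [mul_pos hκ h4]

end HilbertIrreducibility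

/-- Hilbert's irreducibility theorem over the ring ℤ: for polynomials
`P_j(x,y)` irreducible in `ℤ[x,y]`, of degree ≥ 1 in `y`, with no fixed prime
divisor of the product of the specializations, the set of `n ∈ ℤ^r` where every
`P_j(n,y)` is irreducible in `ℤ[y]` has positive lower density for symmetric
boxes, and is Zariski-dense. -/
theorem stmt5 (r m l : ℕ) (hr : 1 ≤ r) (hm : 1 ≤ m) (hl : 1 ≤ l)
    (P : Fin l → MvPolynomial (Fin r ⊕ Fin m) ℤ)
    (hirr : ∀ j, Irreducible (P j))
    (hdeg : ∀ j, ∃ d ∈ (P j).support, ∃ i : Fin m, d (Sum.inr i) ≠ 0)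
    (hnofix : ¬ ∃ p : ℕ, p.Prime ∧ ∀ n : Fin r → ℤ,
      (C (p : ℤ) : MvPolynomial (Fin m) ℤ) ∣ ∏ j, specX r m n (P j)) :
    (0 < Filter.liminf (fun B : ℕ =>
        (Nat.card {n : Fin r → ℤ // (∀ i, -(B : ℤ) ≤ n i ∧ n i ≤ (B : ℤ)) ∧
            ∀ j, Irreducible (specX r m n (P j))} : ℝ) / (2 * (B : ℝ) + 1) ^ r)
      atTop) ∧
    ∀ Q : MvPolynomial (Fin r) ℚ, Q ≠ 0 →
      ∃ n : Fin r → ℤ, (∀ j, Irreducible (specX r m n (P j))) ∧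
        eval (fun i => (n i : ℚ)) Q ≠ 0 := by
  obtain ⟨κ, hκ, h⟩ := HilbertIrreducibility.eventually_le_card_irreducible hirr hdeg hnofix
  exact ⟨HilbertIrreducibility.liminf_card_pos hκ h,
    fun Q hQ => HilbertIrreducibility.exists_eval_ne_zero_of_card hκ h hQ⟩
end

section
/- (Ostrowski-type theorem for coprimality.) Let P_1,…,P_s ∈ ℤ[x_1,…,x_r] (s ≥ 2, r ≥ 1) be nonzero polynomials. The following are equivalent: (i) every common divisor of P_1,…,P_s in ℤ[x] is a constant (an element of ℤ); (ii) P_1,…,P_s are coprime in ℚ[x]; (iii) for all but finitely many primes p, the reductions of P_1,…,P_s modulo p are coprime in (ℤ/pℤ)[x]; (iv) for infinitely many primes p, the reductions of P_1,…,P_s modulo p are coprime in (ℤ/pℤ)[x]. -/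
open MvPolynomial

/-- In a polynomial ring over a unique factorization domain, a nonzero ideal whose elements have no
common divisor of positive degree contains a nonzero constant. -/
theorem Polynomial.exists_C_mem_of_common_divisors_natDegree_eq_zero {A : Type*} [CommRing A]
    [IsDomain A] [UniqueFactorizationMonoid A] (I : Ideal (Polynomial A)) (hI : I ≠ ⊥)
    (h : ∀ D : Polynomial A, (∀ p ∈ I, D ∣ p) → D.natDegree = 0) :
    ∃ a : A, a ≠ 0 ∧ Polynomial.C a ∈ I := by
  let F := FractionRing A
  let := Polynomial.algebra A F
  have hloc := Polynomial.isLocalization (nonZeroDivisors A) F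
  let J : Ideal (Polynomial F) := I.map (algebraMap (Polynomial A) (Polynomial F))
  by_cases hJ : J = ⊤
  · have hnd : ¬ Disjoint
        (((nonZeroDivisors A).map Polynomial.C : Submonoid (Polynomial A)) : Set (Polynomial A))
        (I : Set (Polynomial A)) := fun hd =>
      (IsLocalization.map_algebraMap_ne_top_iff_disjoint
        ((nonZeroDivisors A).map Polynomial.C) (Polynomial F) I).mpr hd hJ
    obtain ⟨_, ⟨a, ha, rfl⟩, hCI⟩ := Set.not_disjoint_iff.mp hnd
    exact ⟨a, nonZeroDivisors.ne_zero ha, hCI⟩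
  · exfalso
    obtain ⟨g, hg⟩ := (IsPrincipalIdealRing.principal J).principal
    have hdvd : ∀ p ∈ I, g ∣ p.map (algebraMap A F) := fun p hp => by
      have hm : p.map (algebraMap A F) ∈ J := Ideal.mem_map_of_mem _ hp
      rw [hg] at hm
      exact Ideal.mem_span_singleton.mp hm
    obtain ⟨q, hqI, hq0⟩ := Submodule.exists_mem_ne_zero_of_ne_bot hI
    have hg0 : g ≠ 0 := by
      rintro rfl
      exact hq0 ((Polynomial.map_eq_zero_iff (IsFractionRing.injective A F)).mp
        (zero_dvd_iff.mp (hdvd q hqI)))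
    let : NormalizationMonoid A := Classical.arbitrary _
    let := UniqueFactorizationMonoid.toNormalizedGCDMonoid A
    let G := IsLocalization.integerNormalization (nonZeroDivisors A) g
    obtain ⟨b, hb, hbG⟩ := IsLocalization.integerNormalization_spec (nonZeroDivisors A) g
    have hb0 : algebraMap A F b ≠ 0 := by simpa using nonZeroDivisors.ne_zero hb
    have hGdvd : G.map (algebraMap A F) ∣ g := by
      rw [hbG, Algebra.smul_def, Polynomial.algebraMap_apply]
      exact (Polynomial.isUnit_C.mpr hb0.isUnit).mul_left_dvd.mpr dvd_rfl
    have hdeg : G.natDegree = 0 := by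
      rw [← Polynomial.natDegree_primPart]
      refine h _ fun p hp => G.isPrimitive_primPart.dvd_of_fraction_map_dvd_fraction_map (K := F) ?_
      exact (Polynomial.map_dvd _ G.primPart_dvd).trans (hGdvd.trans (hdvd p hp))
    apply hJ
    rw [hg]
    refine Ideal.span_singleton_eq_top.mpr ?_
    refine isUnit_of_dvd_unit (y := G.map (algebraMap A F)) ?_ ?_
    · rw [hbG, Algebra.smul_def]
      exact dvd_mul_left _ _
    · have hG0 : G.map (algebraMap A F) ≠ 0 := by
        rw [hbG]
        exact smul_ne_zero (nonZeroDivisors.ne_zero hb) hg0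
      refine Polynomial.isUnit_iff_degree_eq_zero.mpr ?_
      rw [Polynomial.degree_eq_natDegree hG0,
        Polynomial.natDegree_map_eq_of_injective (IsFractionRing.injective A F), hdeg]
      rfl

namespace MvPolynomial

/-- A nonzero ideal of a multivariate polynomial ring whose elements have no common divisor
involving the variable `j` contains a nonzero element not involving `j`. -/
theorem exists_mem_degreeOf_eq_zero {σ A : Type*} [CommRing A] [IsDomain A]
    [UniqueFactorizationMonoid A] (j : σ) (I : Ideal (MvPolynomial σ A)) (hI : I ≠ ⊥)
    (h : ∀ D : MvPolynomial σ A, (∀ p ∈ I, D ∣ p) → D.degreeOf j = 0) :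
    ∃ R ∈ I, R ≠ 0 ∧ R.degreeOf j = 0 := by
  classical
  let e : MvPolynomial σ A ≃ₐ[A] Polynomial (MvPolynomial {b // b ≠ j} A) :=
    (renameEquiv A (Equiv.optionSubtypeNe j).symm).trans (optionEquivLeft A {b // b ≠ j})
  have hdeg (p : MvPolynomial σ A) : p.degreeOf j = (e p).natDegree := degreeOf_eq_natDegree j p
  obtain ⟨a, ha, haI⟩ := Polynomial.exists_C_mem_of_common_divisors_natDegree_eq_zero
    (I.comap e.symm) (by
      obtain ⟨q, hqI, hq0⟩ := Submodule.exists_mem_ne_zero_of_ne_bot hI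
      refine Submodule.ne_bot_iff _ |>.mpr ⟨e q, ?_, by simpa using hq0⟩
      simpa [Ideal.mem_comap] using hqI) (by
      intro D hD
      have := h (e.symm D) fun p hp => by
        have := hD (e p) (by simpa [Ideal.mem_comap] using hp)
        simpa using map_dvd e.symm this
      simpa [hdeg] using this)
  exact ⟨e.symm (Polynomial.C a), by simpa [Ideal.mem_comap] using haI, by simpa using ha,
    by simp [hdeg]⟩

theorem degreeOf_map_le {σ A B : Type*} [CommSemiring A] [CommSemiring B] (f : A →+* B) (j : σ)
    (p : MvPolynomial σ A) : (map f p).degreeOf j ≤ p.degreeOf j := by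
  rw [degreeOf_eq_sup, degreeOf_eq_sup]
  exact Finset.sup_mono (support_map_subset f p)

theorem totalDegree_eq_zero_of_degreeOf_eq_zero {σ A : Type*} [CommSemiring A]
    {p : MvPolynomial σ A} (h : ∀ j, p.degreeOf j = 0) : p.totalDegree = 0 := by
  refine (totalDegree_eq_zero_iff σ p).mpr fun m hm j => ?_
  have := degreeOf_le_iff.mp (h j).le m hm
  omega

theorem exists_coeff_ne_zero_of_totalDegree_ne_zero {σ A : Type*} [CommSemiring A]
    {p : MvPolynomial σ A} (h : p.totalDegree ≠ 0) : ∃ m ≠ 0, p.coeff m ≠ 0 := by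
  contrapose! h
  refine (totalDegree_eq_zero_iff σ p).mpr fun m hm j => ?_
  by_cases h0 : m = 0
  · simp [h0]
  · exact absurd (h m h0) (mem_support_iff.mp hm)

theorem totalDegree_ne_zero_of_coeff_ne_zero {σ A : Type*} [CommSemiring A]
    {p : MvPolynomial σ A} {m : σ →₀ ℕ} (hm : m ≠ 0) (h : p.coeff m ≠ 0) :
    p.totalDegree ≠ 0 := fun h0 =>
  hm (Finsupp.ext ((totalDegree_eq_zero_iff σ p).mp h0 m (mem_support_iff.mpr h)))

/-- Clearing denominators. -/
theorem exists_C_mul_eq_map_int {σ : Type*} (D : MvPolynomial σ ℚ) :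
    ∃ (d : ℤ) (E : MvPolynomial σ ℤ), d ≠ 0 ∧
      C (d : ℚ) * D = map (Int.castRingHom ℚ) E := by
  obtain ⟨⟨E, ⟨_, d, hd, rfl⟩⟩, h⟩ :=
    @IsLocalization.surj _ _ ((nonZeroDivisors ℤ).map (C (σ := σ))) _ _ algebraMvPolynomial
      (isLocalization (nonZeroDivisors ℤ) ℚ) D
  refine ⟨d, E, nonZeroDivisors.ne_zero hd, ?_⟩
  change D * map (Int.castRingHom ℚ) (C d) = map (Int.castRingHom ℚ) E at h
  rwa [map_C, mul_comm, eq_intCast] at h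

end MvPolynomial

theorem finite_primes_intCast_eq_zero {n : ℤ} (hn : n ≠ 0) :
    {p : ℕ | p.Prime ∧ (n : ZMod p) = 0}.Finite := by
  refine (n.natAbs.primeFactors.finite_toSet).subset fun p ⟨hp, h0⟩ => ?_
  rw [ZMod.intCast_zmod_eq_zero_iff_dvd] at h0
  exact Nat.mem_primeFactors.mpr ⟨hp, Int.natCast_dvd.mp h0, Int.natAbs_ne_zero.mpr hn⟩

namespace MvPolynomial

/-- If the common divisors in `ℤ[x]` are constants, the reductions are coprime for almost all
primes. -/
theorem finite_not_coprime_map_zmod {ι σ : Type*} [Finite σ]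
    (P : ι → MvPolynomial σ ℤ) {i₀ : ι} (hP : P i₀ ≠ 0)
    (h : ∀ D : MvPolynomial σ ℤ, (∀ i, D ∣ P i) → ∃ c : ℤ, D = C c) :
    {p : ℕ | p.Prime ∧ ¬ ∀ D : MvPolynomial σ (ZMod p),
      (∀ i, D ∣ (P i).map (Int.castRingHom (ZMod p))) → D.totalDegree = 0}.Finite := by
  have hPI (i : ι) : P i ∈ Ideal.span (Set.range P) := Ideal.subset_span ⟨i, rfl⟩
  have hR (j : σ) : ∃ R ∈ Ideal.span (Set.range P), R ≠ 0 ∧ R.degreeOf j = 0 := by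
    refine exists_mem_degreeOf_eq_zero j _
      (Submodule.ne_bot_iff _ |>.mpr ⟨P i₀, hPI i₀, hP⟩) fun D hD => ?_
    obtain ⟨c, rfl⟩ := h D fun i => hD _ (hPI i)
    exact degreeOf_C c j
  choose R hRI hR0 hRdeg using hR
  choose m hm using fun j => ne_zero_iff.mp (hR0 j)
  refine (Set.finite_iUnion fun j => finite_primes_intCast_eq_zero (hm j)).subset ?_
  rintro p ⟨hp, hD⟩
  by_contra hgood
  have : Fact p.Prime := ⟨hp⟩
  refine hD fun D hD => totalDegree_eq_zero_of_degreeOf_eq_zero fun j => ?_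
  have hle : Ideal.span (Set.range P) ≤
      (Ideal.span {D}).comap (map (Int.castRingHom (ZMod p))) := by
    rw [Ideal.span_le]
    rintro _ ⟨i, rfl⟩
    exact Ideal.mem_span_singleton.mpr (hD i)
  obtain ⟨E, hE⟩ := Ideal.mem_span_singleton.mp (hle (hRI j))
  have hne : map (Int.castRingHom (ZMod p)) (R j) ≠ 0 := fun h0 => by
    refine hgood (Set.mem_iUnion.mpr ⟨j, hp, ?_⟩)
    simpa [coeff_map] using congrArg (coeff (m j)) h0
  have hdeg := degreeOf_map_le (Int.castRingHom (ZMod p)) j (R j)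
  rw [hE] at hne hdeg
  rw [degreeOf_mul_eq (left_ne_zero_of_mul hne) (right_ne_zero_of_mul hne), hRdeg j] at hdeg
  omega

/-- If the reductions are coprime for infinitely many primes, then the polynomials are coprime
over `ℚ`. -/
theorem coprime_map_rat_of_infinite_coprime_map_zmod {ι σ : Type*} [Finite ι]
    (P : ι → MvPolynomial σ ℤ)
    (h : {p : ℕ | p.Prime ∧ ∀ D : MvPolynomial σ (ZMod p),
      (∀ i, D ∣ (P i).map (Int.castRingHom (ZMod p))) → D.totalDegree = 0}.Infinite)
    (D : MvPolynomial σ ℚ) (hD : ∀ i, D ∣ (P i).map (Int.castRingHom ℚ)) :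
    D.totalDegree = 0 := by
  by_contra hdeg
  obtain ⟨m, hm, hcm⟩ := exists_coeff_ne_zero_of_totalDegree_ne_zero hdeg
  obtain ⟨d, D', hd, hD'⟩ := exists_C_mul_eq_map_int D
  have hcm' : D'.coeff m ≠ 0 := fun h0 => by
    have := congrArg (coeff m) hD'
    rw [coeff_C_mul, coeff_map, h0, map_zero] at this
    exact mul_ne_zero (Int.cast_ne_zero.mpr hd) hcm this
  choose E hE using hD
  choose e E' he hE' using fun i => exists_C_mul_eq_map_int (E i)
  have key (i : ι) : C (d * e i : ℤ) * P i = D' * E' i := by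
    apply map_injective (Int.castRingHom ℚ) Int.cast_injective
    rw [map_mul (map _), map_mul (map _), map_C, ← hD', ← hE', hE]
    simp only [map_mul, eq_intCast]
    ring
  obtain ⟨p, ⟨hp, hcop⟩, hgood⟩ := h.exists_notMem_finite
    ((finite_primes_intCast_eq_zero hcm').union
      (Set.finite_iUnion fun i => finite_primes_intCast_eq_zero (mul_ne_zero hd (he i))))
  have : Fact p.Prime := ⟨hp⟩
  simp only [Set.mem_union, Set.mem_iUnion, Set.mem_ofPred_eq, not_or, not_exists, not_and]
    at hgood
  refine totalDegree_ne_zero_of_coeff_ne_zero (p := map (Int.castRingHom (ZMod p)) D') hm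
    (by simpa [coeff_map] using hgood.1 hp) (hcop _ fun i => ?_)
  have hu : IsUnit (C ((d * e i : ℤ) : ZMod p) : MvPolynomial σ (ZMod p)) :=
    (isUnit_iff_ne_zero.mpr (hgood.2 i hp)).map C
  refine (hu.dvd_mul_left).mp ⟨map (Int.castRingHom (ZMod p)) (E' i), ?_⟩
  rw [← map_mul, ← key, map_mul (map _), map_C, eq_intCast]

end MvPolynomial

/-- Ostrowski-type theorem for coprimality over ℤ: for nonzero polynomials
`P_1,…,P_s ∈ ℤ[x]` the following are equivalent: every common divisor in
`ℤ[x]` is constant; the `P_i` are coprime in `ℚ[x]`; their reductions mod `p`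
are coprime in `(ℤ/pℤ)[x]` for all but finitely many primes `p`; the same
holds for infinitely many primes `p`. -/
theorem stmt14 (s r : ℕ) (hs : 2 ≤ s) (hr : 1 ≤ r)
    (P : Fin s → MvPolynomial (Fin r) ℤ) (hP : ∀ i, P i ≠ 0) :
    List.TFAE
      [ (∀ D : MvPolynomial (Fin r) ℤ, (∀ i, D ∣ P i) → ∃ c : ℤ, D = C c),
        (∀ D : MvPolynomial (Fin r) ℚ,
          (∀ i, D ∣ (P i).map (Int.castRingHom ℚ)) → D.totalDegree = 0),
        ({p : ℕ | p.Prime ∧ ¬ (∀ D : MvPolynomial (Fin r) (ZMod p),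
          (∀ i, D ∣ (P i).map (Int.castRingHom (ZMod p))) → D.totalDegree = 0)}).Finite,
        ({p : ℕ | p.Prime ∧ (∀ D : MvPolynomial (Fin r) (ZMod p),
          (∀ i, D ∣ (P i).map (Int.castRingHom (ZMod p))) → D.totalDegree = 0)}).Infinite ] := by
  tfae_have 1 → 3 := finite_not_coprime_map_zmod P (hP ⟨0, by omega⟩)
  tfae_have 3 → 4 := fun h =>
    (Nat.infinite_setOfPred_prime.sdiff h).mono fun p hp =>
      ⟨hp.1, by_contra fun hc => hp.2 ⟨hp.1, hc⟩⟩
  tfae_have 4 → 2 := coprime_map_rat_of_infinite_coprime_map_zmod P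
  tfae_have 2 → 1 := fun h D hD => by
    have h0 := h (map (Int.castRingHom ℚ) D) fun i => map_dvd (map (Int.castRingHom ℚ)) (hD i)
    refine ⟨coeff 0 D, totalDegree_eq_zero_iff_eq_C.mp ?_⟩
    by_contra hdeg
    obtain ⟨m, hm, hc⟩ := exists_coeff_ne_zero_of_totalDegree_ne_zero hdeg
    exact totalDegree_ne_zero_of_coeff_ne_zero hm (by simpa [coeff_map] using hc) h0
  tfae_finish
end
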